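/- arXiv:2404.13942 — 4 statements merged into one kernel-verified Lean document; each statement's English description precedes it below -/
import Mathlib

section
/- (Russo–Seymour–Welsh lemma) There exists a continuous function f : (0,1) → (0,1) such that for every p ∈ (0,1) and every integer m ≥ 1, the crossing probabilities of bond percolation on ℤ² satisfy π_p(4m, 2m) ≥ f(π_p(2m, 2m)). -/
open MeasureTheory

/-- `e` is an edge of the square lattice `ℤ²`: an unordered pair of vertices at
`ℓ¹`-distance `1`. -/
def IsLatticeEdge (e : Sym2 (ℤ × ℤ)) : Prop :=
  ∃ u v : ℤ × ℤ, e = s(u, v) ∧ |u.1 - v.1| + |u.2 - v.2| = 1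

/-- The edges of the square lattice `ℤ²`. -/
def LatticeEdge : Type := {e : Sym2 (ℤ × ℤ) // IsLatticeEdge e}

/-- A percolation configuration declares each edge of `ℤ²` open (`true`) or closed. -/
abbrev PercConfig : Type := LatticeEdge → Bool

instance : MeasurableSpace PercConfig := MeasurableSpace.pi

/-- `μ` is the product over the edges of `ℤ²` of Bernoulli(`p`) measures: the states of the
edges are independent, each being open with probability `p` and closed with probability
`1 - p`. -/
def IsBernoulliProduct (p : ℝ) (μ : Measure PercConfig) : Prop :=
  ∀ (S : Finset LatticeEdge) (b : LatticeEdge → Bool),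
    μ {ω : PercConfig | ∀ e ∈ S, ω e = b e} =
      ∏ e ∈ S, ENNReal.ofReal (if b e then p else 1 - p)

/-- The vertex `v` lies in the rectangle `[0, m] × [0, n]`. -/
def InRect (m n : ℕ) (v : ℤ × ℤ) : Prop :=
  0 ≤ v.1 ∧ v.1 ≤ (m : ℤ) ∧ 0 ≤ v.2 ∧ v.2 ≤ (n : ℤ)

/-- The sponge-crossing event: there is a path of open edges, all of whose vertices lie in
the rectangle `[0, m] × [0, n]`, joining some vertex of the left side to some vertex of the
right side. -/
def Crossing (m n : ℕ) (ω : PercConfig) : Prop :=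
  ∃ (k : ℕ) (x : Fin (k + 1) → ℤ × ℤ),
    (∀ i : Fin (k + 1), InRect m n (x i)) ∧
    (x 0).1 = 0 ∧ (x (Fin.last k)).1 = (m : ℤ) ∧
    ∀ i : Fin k, ∃ h : IsLatticeEdge s(x i.castSucc, x i.succ),
      ω ⟨s(x i.castSucc, x i.succ), h⟩ = true

namespace Percolation

open Relation

noncomputable instance : DecidableEq LatticeEdge := Classical.decEq _

/-! ### Events determined by finitely many edges -/

/-- The event `A` depends only on the states of the edges in `S`. -/
def DeterminedBy (A : Set PercConfig) (S : Set LatticeEdge) : Prop :=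
  ∀ ω ω' : PercConfig, (∀ e ∈ S, ω e = ω' e) → ω ∈ A → ω' ∈ A

theorem DeterminedBy.mono {A : Set PercConfig} {S T : Set LatticeEdge} (h : DeterminedBy A S)
    (hST : S ⊆ T) : DeterminedBy A T :=
  fun ω ω' hω => h ω ω' fun e he => hω e (hST he)

theorem DeterminedBy.inter {A B : Set PercConfig} {S : Set LatticeEdge} (hA : DeterminedBy A S)
    (hB : DeterminedBy B S) : DeterminedBy (A ∩ B) S :=
  fun ω ω' h hω => ⟨hA ω ω' h hω.1, hB ω ω' h hω.2⟩

/-- The configurations that agree with `b` on `S`. -/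
def cylinder (S : Finset LatticeEdge) (b : PercConfig) : Set PercConfig :=
  {ω | ∀ e ∈ S, ω e = b e}

theorem measurableSet_cylinder (S : Finset LatticeEdge) (b : PercConfig) :
    MeasurableSet (cylinder S b) := by
  have h : cylinder S b = ⋂ e ∈ S, (fun ω : PercConfig => ω e) ⁻¹' {b e} := by
    ext ω; simp [cylinder]
  rw [h]
  exact Finset.measurableSet_biInter S fun e _ => measurable_pi_apply e (measurableSet_singleton _)

open Classical in
/-- Extension of a configuration on `S` by closed edges. -/
noncomputable def extend (S : Finset LatticeEdge) (b : S → Bool) : PercConfig :=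
  fun e => if h : e ∈ S then b ⟨e, h⟩ else false

theorem extend_apply {S : Finset LatticeEdge} (b : S → Bool) (e : S) : extend S b e = b e := by
  simp [extend]

theorem extend_mono {S : Finset LatticeEdge} : Monotone (extend S) := by
  intro b c h e
  by_cases he : e ∈ S
  · simpa [extend, he] using h ⟨e, he⟩
  · simp [extend, he]

theorem mem_cylinder_extend_iff {S : Finset LatticeEdge} {b : S → Bool} {ω : PercConfig} :
    ω ∈ cylinder S (extend S b) ↔ b = fun e : S => ω e := by
  constructor
  · intro h
    funext e
    rw [h e e.2, extend_apply]
  · rintro rfl e he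
    simp [extend, he]

theorem DeterminedBy.mem_iff {A : Set PercConfig} {S : Finset LatticeEdge}
    (hA : DeterminedBy A S) (ω : PercConfig) :
    ω ∈ A ↔ extend S (fun e : S => ω e) ∈ A := by
  have h : ω ∈ cylinder S (extend S fun e : S => ω e) := mem_cylinder_extend_iff.2 rfl
  exact ⟨hA _ _ fun e he => h e he, hA _ _ fun e he => (h e he).symm⟩

open Classical in
theorem DeterminedBy.inter_eq_biUnion {A : Set PercConfig} {S : Finset LatticeEdge}
    (hA : DeterminedBy A S) (B : Set PercConfig) :
    A ∩ B = ⋃ b ∈ Finset.univ.filter (fun b : S → Bool => extend S b ∈ A),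
      cylinder S (extend S b) ∩ B := by
  ext ω
  simp only [Set.mem_inter_iff, Set.mem_iUnion, Finset.mem_filter, Finset.mem_univ, true_and,
    mem_cylinder_extend_iff, exists_prop]
  rw [hA.mem_iff ω]
  constructor
  · rintro ⟨h, hB⟩
    exact ⟨_, h, rfl, hB⟩
  · rintro ⟨b, h, rfl, hB⟩
    exact ⟨h, hB⟩

theorem DeterminedBy.measurableSet {A : Set PercConfig} {S : Set LatticeEdge} (hS : S.Finite)
    (hA : DeterminedBy A S) : MeasurableSet A := by
  classical
  have hA' : DeterminedBy A (hS.toFinset : Set LatticeEdge) := by simpa using hA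
  have h := hA'.inter_eq_biUnion Set.univ
  rw [Set.inter_univ] at h
  rw [h]
  exact Finset.measurableSet_biUnion _ fun b _ =>
    (measurableSet_cylinder _ _).inter MeasurableSet.univ

theorem DeterminedBy.measureReal_inter {A B : Set PercConfig} {S : Finset LatticeEdge}
    (hA : DeterminedBy A S) (hB : MeasurableSet B) (μ : Measure PercConfig)
    [IsProbabilityMeasure μ] :
    μ.real (A ∩ B) =
      ∑ b : S → Bool, A.indicator 1 (extend S b) * μ.real (cylinder S (extend S b) ∩ B) := by
  classical
  rw [hA.inter_eq_biUnion B, measureReal_biUnion_finset, Finset.sum_filter]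
  · refine Finset.sum_congr rfl fun b _ => ?_
    by_cases h : extend S b ∈ A <;> simp [h]
  · intro b _ c _ hbc
    refine Set.disjoint_left.2 fun ω hb hc => hbc ?_
    rw [mem_cylinder_extend_iff.1 hb.1, mem_cylinder_extend_iff.1 hc.1]
  · exact fun b _ => (measurableSet_cylinder _ _).inter hB

/-- The probability of the state `c` of a single edge. -/
def edgeWeight (p : ℝ) (c : Bool) : ℝ := if c then p else 1 - p

theorem edgeWeight_nonneg {p : ℝ} (hp : p ∈ Set.Ioo (0 : ℝ) 1) (c : Bool) :
    0 ≤ edgeWeight p c := by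
  have := hp.1; have := hp.2
  unfold edgeWeight
  split_ifs <;> linarith

section Bernoulli

variable {p : ℝ} {μ : Measure PercConfig}

theorem measureReal_cylinder (hp : p ∈ Set.Ioo (0 : ℝ) 1) (hμ : IsBernoulliProduct p μ)
    (S : Finset LatticeEdge) (b : PercConfig) :
    μ.real (cylinder S b) = ∏ e ∈ S, edgeWeight p (b e) := by
  rw [Measure.real, cylinder, hμ S b, ENNReal.toReal_prod]
  refine Finset.prod_congr rfl fun e _ => ?_
  rw [← ENNReal.toReal_ofReal (edgeWeight_nonneg hp (b e))]
  rfl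

variable [IsProbabilityMeasure μ]

theorem DeterminedBy.measureReal_eq (hp : p ∈ Set.Ioo (0 : ℝ) 1) (hμ : IsBernoulliProduct p μ)
    {A : Set PercConfig} {S : Finset LatticeEdge} (hA : DeterminedBy A S) :
    μ.real A = ∑ b : S → Bool, A.indicator 1 (extend S b) * ∏ e : S, edgeWeight p (b e) := by
  have h := hA.measureReal_inter MeasurableSet.univ μ
  rw [Set.inter_univ] at h
  rw [h]
  refine Finset.sum_congr rfl fun b _ => ?_
  rw [Set.inter_univ, measureReal_cylinder hp hμ, ← Finset.prod_coe_sort]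
  simp only [extend_apply]

/-- Events determined by disjoint sets of edges are independent. -/
theorem measureReal_inter_of_disjoint (hp : p ∈ Set.Ioo (0 : ℝ) 1)
    (hμ : IsBernoulliProduct p μ) {A B : Set PercConfig} {S T : Set LatticeEdge}
    (hS : S.Finite) (hT : T.Finite) (hST : Disjoint S T) (hA : DeterminedBy A S)
    (hB : DeterminedBy B T) : μ.real (A ∩ B) = μ.real A * μ.real B := by
  classical
  lift S to Finset LatticeEdge using hS
  lift T to Finset LatticeEdge using hT
  have hST' : Disjoint S T := by exact_mod_cast hST
  have hBm := hB.measurableSet T.finite_toSet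
  rw [hA.measureReal_inter hBm, hA.measureReal_eq hp hμ, Finset.sum_mul]
  refine Finset.sum_congr rfl fun b _ => ?_
  rw [mul_assoc]
  congr 1
  rw [Set.inter_comm, hB.measureReal_inter (measurableSet_cylinder _ _), hB.measureReal_eq hp hμ,
    Finset.mul_sum]
  refine Finset.sum_congr rfl fun c _ => ?_
  rw [mul_left_comm]
  congr 1
  set w : PercConfig := fun e => if e ∈ S then extend S b e else extend T c e with hw
  have hwS : ∀ e ∈ S, w e = extend S b e := fun e he => by simp [hw, he]
  have hwT : ∀ e ∈ T, w e = extend T c e := fun e he => by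
    simp [hw, Finset.disjoint_right.1 hST' he]
  have h : cylinder T (extend T c) ∩ cylinder S (extend S b) = cylinder (S ∪ T) w := by
    ext ω
    simp only [cylinder, Set.mem_inter_iff, Set.mem_ofPred_eq, Finset.mem_union]
    constructor
    · rintro ⟨h1, h2⟩ e (he | he)
      · rw [h2 e he, hwS e he]
      · rw [h1 e he, hwT e he]
    · intro h
      exact ⟨fun e he => by rw [h e (Or.inr he), hwT e he],
        fun e he => by rw [h e (Or.inl he), hwS e he]⟩
  rw [h, measureReal_cylinder hp hμ, Finset.prod_union hST', ← Finset.prod_coe_sort S,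
    ← Finset.prod_coe_sort T]
  congr 1
  · exact Finset.prod_congr rfl fun e _ => by rw [hwS e e.2, extend_apply]
  · exact Finset.prod_congr rfl fun e _ => by rw [hwT e e.2, extend_apply]

/-- **Harris' inequality** for increasing events determined by finitely many edges. -/
theorem harris_inequality (hp : p ∈ Set.Ioo (0 : ℝ) 1) (hμ : IsBernoulliProduct p μ)
    {A B : Set PercConfig} {S T : Set LatticeEdge} (hS : S.Finite) (hT : T.Finite)
    (hA : DeterminedBy A S) (hB : DeterminedBy B T) (hA' : IsUpperSet A) (hB' : IsUpperSet B) :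
    μ.real A * μ.real B ≤ μ.real (A ∩ B) := by
  classical
  obtain ⟨U, hU⟩ : ∃ U : Finset LatticeEdge, (U : Set LatticeEdge) = S ∪ T :=
    ⟨(hS.union hT).toFinset, by simp⟩
  have hAU : DeterminedBy A U := hA.mono (hU ▸ Set.subset_union_left)
  have hBU : DeterminedBy B U := hB.mono (hU ▸ Set.subset_union_right)
  have hmono : ∀ {C : Set PercConfig}, IsUpperSet C →
      Monotone fun b : U → Bool => C.indicator (1 : PercConfig → ℝ) (extend U b) := by
    intro C hC b c hbc
    by_cases hb : extend U b ∈ C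
    · simp [hb, hC (extend_mono hbc) hb]
    · simp only [hb, not_false_eq_true, Set.indicator_of_notMem]
      exact Set.indicator_nonneg (fun _ _ => zero_le_one) _
  have hnn : ∀ C : Set PercConfig,
      (0 : (U → Bool) → ℝ) ≤ fun b => C.indicator (1 : PercConfig → ℝ) (extend U b) :=
    fun C b => Set.indicator_nonneg (fun _ _ => zero_le_one) _
  have key := fkg (μ := fun b : U → Bool => ∏ e : U, edgeWeight p (b e))
    (f := fun b => A.indicator (1 : PercConfig → ℝ) (extend U b))
    (g := fun b => B.indicator (1 : PercConfig → ℝ) (extend U b))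
    (fun b => Finset.prod_nonneg fun e _ => edgeWeight_nonneg hp _) (hnn A) (hnn B)
    (hmono hA') (hmono hB') (fun b c => by
      rw [← Finset.prod_mul_distrib, ← Finset.prod_mul_distrib]
      refine le_of_eq (Finset.prod_congr rfl fun e _ => ?_)
      simp only [Pi.inf_apply, Pi.sup_apply]
      cases b e <;> cases c e <;> simp [mul_comm])
  have h1 : ∑ b : U → Bool, ∏ e : U, edgeWeight p (b e) = 1 := by
    have h := DeterminedBy.measureReal_eq hp hμ (A := Set.univ) (S := U)
      (fun _ _ _ _ => Set.mem_univ _)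
    simpa using h.symm
  rw [hAU.measureReal_eq hp hμ, hBU.measureReal_eq hp hμ, (hAU.inter hBU).measureReal_eq hp hμ]
  simp only [h1, one_mul] at key
  calc _ = _ := by
        congr 1 <;> exact Finset.sum_congr rfl fun b _ => mul_comm _ _
    _ ≤ _ := key
    _ = _ := by
        refine Finset.sum_congr rfl fun b _ => ?_
        rw [Set.inter_indicator_one, Pi.mul_apply]
        ring

end Bernoulli

/-! ### Open connections -/

theorem isLatticeEdge_iff {u v : ℤ × ℤ} :
    IsLatticeEdge s(u, v) ↔ |u.1 - v.1| + |u.2 - v.2| = 1 := by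
  constructor
  · rintro ⟨u', v', h, h1⟩
    rcases Sym2.eq_iff.1 h with ⟨rfl, rfl⟩ | ⟨rfl, rfl⟩
    · exact h1
    · rwa [abs_sub_comm u.1, abs_sub_comm u.2]
  · exact fun h => ⟨u, v, rfl, h⟩

/-- The vertices `u` and `v` are joined by an edge which is open in `ω`. -/
def OpenAdj (ω : PercConfig) (u v : ℤ × ℤ) : Prop :=
  ∃ h : IsLatticeEdge s(u, v), ω ⟨s(u, v), h⟩ = true

theorem OpenAdj.symm {ω : PercConfig} {u v : ℤ × ℤ} (h : OpenAdj ω u v) : OpenAdj ω v u := by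
  obtain ⟨h, h1⟩ := h
  have h2 : s(u, v) = s(v, u) := Sym2.eq_swap
  exact ⟨h2 ▸ h, by rw [← h1]; congr 2; exact h2.symm⟩

theorem OpenAdj.mono {ω ω' : PercConfig} (hω : ω ≤ ω') {u v : ℤ × ℤ} (h : OpenAdj ω u v) :
    OpenAdj ω' u v := by
  obtain ⟨h, h1⟩ := h
  have := hω ⟨s(u, v), h⟩
  rw [h1] at this
  exact ⟨h, top_le_iff.1 this⟩

theorem OpenAdj.eq_add {ω : PercConfig} {u v : ℤ × ℤ} (h : OpenAdj ω u v) :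
    v = (u.1 + 1, u.2) ∨ u = (v.1 + 1, v.2) ∨ v = (u.1, u.2 + 1) ∨ u = (v.1, v.2 + 1) := by
  have h1 := isLatticeEdge_iff.1 h.1
  simp only [Prod.ext_iff]
  rcases abs_cases (u.1 - v.1) with h2 | h2 <;> rcases abs_cases (u.2 - v.2) with h3 | h3 <;> omega

/-- One step along an open edge inside the region `R`. -/
def OpenStep (ω : PercConfig) (R : Set (ℤ × ℤ)) (u v : ℤ × ℤ) : Prop :=
  u ∈ R ∧ v ∈ R ∧ OpenAdj ω u v

theorem OpenStep.symm {ω : PercConfig} {R : Set (ℤ × ℤ)} {u v : ℤ × ℤ} (h : OpenStep ω R u v) :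
    OpenStep ω R v u := ⟨h.2.1, h.1, h.2.2.symm⟩

theorem OpenStep.mono {ω ω' : PercConfig} (hω : ω ≤ ω') {R R' : Set (ℤ × ℤ)} (hR : R ⊆ R')
    {u v : ℤ × ℤ} (h : OpenStep ω R u v) : OpenStep ω' R' u v :=
  ⟨hR h.1, hR h.2.1, h.2.2.mono hω⟩

/-- `u` and `v` are joined by an open path inside the region `R`. -/
def Joined (ω : PercConfig) (R : Set (ℤ × ℤ)) (u v : ℤ × ℤ) : Prop :=
  u ∈ R ∧ ReflTransGen (OpenStep ω R) u v

namespace Joined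

variable {ω ω' : PercConfig} {R R' : Set (ℤ × ℤ)} {u v w : ℤ × ℤ}

theorem refl (h : u ∈ R) : Joined ω R u u := ⟨h, .refl⟩

theorem right_mem (h : Joined ω R u v) : v ∈ R := by
  obtain ⟨hu, h⟩ := h
  induction h with
  | refl => exact hu
  | tail _ h _ => exact h.2.1

theorem trans (h : Joined ω R u v) (h' : Joined ω R v w) : Joined ω R u w :=
  ⟨h.1, h.2.trans h'.2⟩

theorem tail (h : Joined ω R u v) (h' : OpenStep ω R v w) : Joined ω R u w :=
  ⟨h.1, h.2.tail h'⟩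

theorem symm (h : Joined ω R u v) : Joined ω R v u :=
  ⟨h.right_mem, (@ReflTransGen.stdSymm _ _ ⟨fun _ _ h => OpenStep.symm h⟩).symm _ _ h.2⟩

theorem mono (hω : ω ≤ ω') (hR : R ⊆ R') (h : Joined ω R u v) : Joined ω' R' u v :=
  ⟨hR h.1, ReflTransGen.mono (fun _ _ h => OpenStep.mono hω hR h) _ _ h.2⟩

/-- A path from `u` to `v` stays in the set of all vertices joined to `u`. -/
theorem within_cluster (h : Joined ω R u v) : Joined ω {x | Joined ω R u x} u v := by
  refine ⟨refl h.1, ?_⟩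
  obtain ⟨hu, h⟩ := h
  induction h with
  | refl => exact .refl
  | @tail b c hb hbc ih =>
    exact ih.tail ⟨⟨hu, hb⟩, ⟨hu, hb.tail hbc⟩, hbc.2.2⟩

end Joined

/-- The edges with both endpoints in `R`. -/
def edgesIn (R : Set (ℤ × ℤ)) : Set LatticeEdge := {e | ∀ v ∈ e.1, v ∈ R}

theorem finite_edgesIn {R : Set (ℤ × ℤ)} (hR : R.Finite) : (edgesIn R).Finite := by
  have h : (Set.image (fun x : (ℤ × ℤ) × (ℤ × ℤ) => s(x.1, x.2)) (R ×ˢ R)).Finite :=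
    (hR.prod hR).image _
  refine Set.Finite.of_finite_image (f := Subtype.val) (h.subset ?_) Subtype.val_injective.injOn
  rintro _ ⟨⟨e, he⟩, hR, rfl⟩
  induction e with
  | h u v =>
    exact ⟨(u, v), ⟨hR u (by simp), hR v (by simp)⟩, rfl⟩

/-- The event that some vertex of `A` is joined to some vertex of `B` inside `R`. -/
def joinEvent (R A B : Set (ℤ × ℤ)) : Set PercConfig :=
  {ω | ∃ u ∈ A, ∃ v ∈ B, Joined ω R u v}

theorem isUpperSet_joinEvent (R A B : Set (ℤ × ℤ)) : IsUpperSet (joinEvent R A B) := by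
  rintro ω ω' hω ⟨u, hu, v, hv, h⟩
  exact ⟨u, hu, v, hv, h.mono hω subset_rfl⟩

theorem OpenAdj.congr {ω ω' : PercConfig} {u v : ℤ × ℤ} (h : OpenAdj ω u v)
    (h' : ∀ e : LatticeEdge, e.1 = s(u, v) → ω e = ω' e) : OpenAdj ω' u v := by
  obtain ⟨h, h1⟩ := h
  exact ⟨h, (h' ⟨s(u, v), h⟩ rfl).symm.trans h1⟩

theorem determinedBy_joinEvent (R A B : Set (ℤ × ℤ)) :
    DeterminedBy (joinEvent R A B) (edgesIn R) := by
  rintro ω ω' hω ⟨u, hu, v, hv, huR, h⟩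
  refine ⟨u, hu, v, hv, huR, ReflTransGen.mono (fun a b hab => ?_) _ _ h⟩
  refine ⟨hab.1, hab.2.1, hab.2.2.congr ?_⟩
  intro e he
  refine hω e fun w hw => ?_
  rw [he, Sym2.mem_iff] at hw
  rcases hw with rfl | rfl
  exacts [hab.1, hab.2.1]

/-! ### Lattice symmetries -/

/-- `φ` maps the edges of the lattice to edges of the lattice. -/
def IsLatticeAut (φ : (ℤ × ℤ) ≃ (ℤ × ℤ)) : Prop :=
  ∀ u v, IsLatticeEdge s(φ u, φ v) ↔ IsLatticeEdge s(u, v)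

theorem IsLatticeAut.symm {φ : (ℤ × ℤ) ≃ (ℤ × ℤ)} (hφ : IsLatticeAut φ) :
    IsLatticeAut φ.symm := by
  intro u v
  rw [← hφ, φ.apply_symm_apply, φ.apply_symm_apply]

theorem IsLatticeAut.isLatticeEdge_map {φ : (ℤ × ℤ) ≃ (ℤ × ℤ)} (hφ : IsLatticeAut φ)
    (e : LatticeEdge) : IsLatticeEdge (Sym2.map φ e.1) := by
  obtain ⟨e, he⟩ := e
  induction e with
  | h u v => exact (hφ u v).2 he

/-- The action of a lattice automorphism on edges. -/
def edgeEquiv {φ : (ℤ × ℤ) ≃ (ℤ × ℤ)} (hφ : IsLatticeAut φ) : LatticeEdge ≃ LatticeEdge where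
  toFun e := ⟨Sym2.map φ e.1, hφ.isLatticeEdge_map e⟩
  invFun e := ⟨Sym2.map φ.symm e.1, hφ.symm.isLatticeEdge_map e⟩
  left_inv e := Subtype.ext (by simp [Sym2.map_map])
  right_inv e := Subtype.ext (by simp [Sym2.map_map])

/-- The configuration `ω` seen through a lattice automorphism. -/
def pullback {φ : (ℤ × ℤ) ≃ (ℤ × ℤ)} (hφ : IsLatticeAut φ) (ω : PercConfig) : PercConfig :=
  fun e => ω (edgeEquiv hφ e)

section Symmetry

variable {φ : (ℤ × ℤ) ≃ (ℤ × ℤ)} (hφ : IsLatticeAut φ)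

theorem openAdj_pullback {ω : PercConfig} {u v : ℤ × ℤ} :
    OpenAdj (pullback hφ ω) u v ↔ OpenAdj ω (φ u) (φ v) :=
  ⟨fun h => ⟨(hφ u v).2 h.1, h.2⟩, fun h => ⟨(hφ u v).1 h.1, h.2⟩⟩

theorem measurable_pullback : Measurable (pullback hφ) :=
  measurable_pi_lambda _ fun _ => measurable_pi_apply _

theorem isBernoulliProduct_map_pullback {p : ℝ} {μ : Measure PercConfig}
    (hμ : IsBernoulliProduct p μ) : IsBernoulliProduct p (μ.map (pullback hφ)) := by
  intro S b
  have h := hμ (S.map (edgeEquiv hφ).toEmbedding) (fun e => b ((edgeEquiv hφ).symm e))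
  rw [Finset.prod_map] at h
  refine (Measure.map_apply (measurable_pullback hφ) (measurableSet_cylinder S b)).trans ?_
  simp only [Equiv.coe_toEmbedding, Equiv.symm_apply_apply] at h
  rw [← h]
  congr 1
  ext ω
  simp only [pullback, cylinder, Set.mem_preimage, Set.mem_ofPred_eq, Finset.mem_map_equiv]
  refine ⟨fun h e he => ?_, fun h e he => ?_⟩
  · simpa using h _ he
  · simpa [he] using h (edgeEquiv hφ e)

theorem measureReal_preimage_pullback {p : ℝ} {μ : Measure PercConfig} [IsProbabilityMeasure μ]
    (hp : p ∈ Set.Ioo (0 : ℝ) 1) (hμ : IsBernoulliProduct p μ) {A : Set PercConfig}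
    {S : Set LatticeEdge} (hS : S.Finite) (hA : DeterminedBy A S) :
    μ.real (pullback hφ ⁻¹' A) = μ.real A := by
  have hm := measurable_pullback hφ
  have hAm := hA.measurableSet hS
  lift S to Finset LatticeEdge using hS
  have := Measure.isProbabilityMeasure_map (μ := μ) hm.aemeasurable
  rw [← map_measureReal_apply hm hAm, hA.measureReal_eq hp hμ,
    hA.measureReal_eq hp (isBernoulliProduct_map_pullback hφ hμ)]

theorem joined_pullback {ω : PercConfig} {R : Set (ℤ × ℤ)} {u v : ℤ × ℤ} :
    Joined (pullback hφ ω) (φ ⁻¹' R) u v ↔ Joined ω R (φ u) (φ v) := by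
  refine and_congr Iff.rfl ⟨fun h => ?_, fun h => ?_⟩
  · exact h.lift φ fun a b hab => ⟨hab.1, hab.2.1, (openAdj_pullback hφ).1 hab.2.2⟩
  · have h' : ReflTransGen (OpenStep (pullback hφ ω) (φ ⁻¹' R)) (φ.symm (φ u)) (φ.symm (φ v)) :=
      h.lift φ.symm fun a b hab => ⟨by simpa using hab.1, by simpa using hab.2.1,
        (openAdj_pullback hφ).2 (by simpa using hab.2.2)⟩
    simpa using h'

end Symmetry

theorem measureReal_joinEvent_preimage {φ : (ℤ × ℤ) ≃ (ℤ × ℤ)} (hφ : IsLatticeAut φ) {p : ℝ}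
    {μ : Measure PercConfig} [IsProbabilityMeasure μ]
    (hp : p ∈ Set.Ioo (0 : ℝ) 1) (hμ : IsBernoulliProduct p μ) {R : Set (ℤ × ℤ)} (hR : R.Finite)
    (A B : Set (ℤ × ℤ)) :
    μ.real (joinEvent (φ ⁻¹' R) (φ ⁻¹' A) (φ ⁻¹' B)) = μ.real (joinEvent R A B) := by
  rw [← measureReal_preimage_pullback hφ hp hμ (finite_edgesIn (hR.preimage φ.injective.injOn))
    (determinedBy_joinEvent _ _ _)]
  congr 1
  ext ω
  constructor
  · rintro ⟨u, hu, v, hv, h⟩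
    exact ⟨φ u, hu, φ v, hv, (joined_pullback hφ).1 h⟩
  · rintro ⟨u, hu, v, hv, h⟩
    obtain ⟨u, rfl⟩ := φ.surjective u
    obtain ⟨v, rfl⟩ := φ.surjective v
    exact ⟨u, hu, v, hv, (joined_pullback hφ).2 h⟩

/-- The reflection of the plane in the line `2 x = c`. -/
def reflect (c : ℤ) : (ℤ × ℤ) ≃ (ℤ × ℤ) := (Equiv.subLeft c).prodCongr (Equiv.refl ℤ)

theorem isLatticeAut_reflect (c : ℤ) : IsLatticeAut (reflect c) := by
  intro u v
  simp only [isLatticeEdge_iff, reflect, Equiv.prodCongr_apply, Prod.map_fst, Prod.map_snd,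
    Equiv.subLeft_apply, Equiv.refl_apply, sub_sub_sub_cancel_left]
  rw [abs_sub_comm v.1]

/-- The horizontal translation by `c`. -/
def translate (c : ℤ) : (ℤ × ℤ) ≃ (ℤ × ℤ) := (Equiv.addRight c).prodCongr (Equiv.refl ℤ)

theorem isLatticeAut_translate (c : ℤ) : IsLatticeAut (translate c) := by
  intro u v
  simp [isLatticeEdge_iff, translate]

theorem isLatticeAut_prodComm : IsLatticeAut (Equiv.prodComm ℤ ℤ) := by
  intro u v
  simp [isLatticeEdge_iff, add_comm]

/-! ### Chains modulo two -/

/-- The indicator of the vertex `u`, modulo two. -/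
def vertexIndicator (u w : ℤ × ℤ) : ZMod 2 := if u = w then 1 else 0

/-- Every path carries a chain modulo two whose boundary consists of the two endpoints. Here
`bh x y` is the coefficient of the edge from `(x, y)` to `(x + 1, y)` and `bv x y` that of the
edge from `(x, y)` to `(x, y + 1)`. -/
theorem Joined.exists_chain {ω : PercConfig} {R : Set (ℤ × ℤ)} {u v : ℤ × ℤ}
    (h : Joined ω R u v) :
    ∃ bh bv : ℤ → ℤ → ZMod 2,
      (∀ x y, bh x y ≠ 0 → OpenStep ω R (x, y) (x + 1, y)) ∧
      (∀ x y, bv x y ≠ 0 → OpenStep ω R (x, y) (x, y + 1)) ∧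
      ∀ x y, bh (x - 1) y + bh x y + bv x (y - 1) + bv x y =
        vertexIndicator u (x, y) + vertexIndicator v (x, y) := by
  obtain ⟨-, h⟩ := h
  induction h with
  | refl => exact ⟨0, 0, by simp, by simp, fun x y => by simp [CharTwo.add_self_eq_zero]⟩
  | @tail b c _ hbc ih =>
    obtain ⟨bh, bv, hh, hv, hb⟩ := ih
    have hhor : ∀ b c : ℤ × ℤ, c = (b.1 + 1, b.2) → OpenStep ω R b c →
        ∃ bh' : ℤ → ℤ → ZMod 2,
        (∀ x y, bh' x y ≠ 0 → OpenStep ω R (x, y) (x + 1, y)) ∧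
        ∀ x y, bh' (x - 1) y + bh' x y = bh (x - 1) y + bh x y +
          (vertexIndicator b (x, y) + vertexIndicator c (x, y)) := by
      rintro ⟨p, q⟩ c rfl hbc
      refine ⟨fun x y => bh x y + if x = p ∧ y = q then 1 else 0, fun x y hne => ?_,
        fun x y => ?_⟩
      · by_cases hxy : x = p ∧ y = q
        · rw [hxy.1, hxy.2]; exact hbc
        · exact hh x y (by simpa [hxy] using hne)
      · simp only [vertexIndicator, Prod.mk.injEq]
        have h1 : (x - 1 = p ∧ y = q) ↔ (p + 1 = x ∧ q = y) := by omega
        have h2 : (x = p ∧ y = q) ↔ (p = x ∧ q = y) := by omega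
        simp only [h1, h2]
        ring
    have hver : ∀ b c : ℤ × ℤ, c = (b.1, b.2 + 1) → OpenStep ω R b c →
        ∃ bv' : ℤ → ℤ → ZMod 2,
        (∀ x y, bv' x y ≠ 0 → OpenStep ω R (x, y) (x, y + 1)) ∧
        ∀ x y, bv' x (y - 1) + bv' x y = bv x (y - 1) + bv x y +
          (vertexIndicator b (x, y) + vertexIndicator c (x, y)) := by
      rintro ⟨p, q⟩ c rfl hbc
      refine ⟨fun x y => bv x y + if x = p ∧ y = q then 1 else 0, fun x y hne => ?_,
        fun x y => ?_⟩
      · by_cases hxy : x = p ∧ y = q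
        · rw [hxy.1, hxy.2]; exact hbc
        · exact hv x y (by simpa [hxy] using hne)
      · simp only [vertexIndicator, Prod.mk.injEq]
        have h1 : (x = p ∧ y - 1 = q) ↔ (p = x ∧ q + 1 = y) := by omega
        have h2 : (x = p ∧ y = q) ↔ (p = x ∧ q = y) := by omega
        simp only [h1, h2]
        ring
    have hb' : ∀ x y, bh (x - 1) y + bh x y + bv x (y - 1) + bv x y +
        (vertexIndicator b (x, y) + vertexIndicator c (x, y)) =
        vertexIndicator u (x, y) + vertexIndicator c (x, y) := by
      intro x y
      rw [hb]
      linear_combination CharTwo.add_self_eq_zero (vertexIndicator b (x, y))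
    rcases hbc.2.2.eq_add with h | h | h | h
    · obtain ⟨bh', h1, h2⟩ := hhor b c h hbc
      exact ⟨bh', bv, h1, hv, fun x y => by linear_combination h2 x y + hb' x y⟩
    · obtain ⟨bh', h1, h2⟩ := hhor c b h hbc.symm
      exact ⟨bh', bv, h1, hv, fun x y => by linear_combination h2 x y + hb' x y⟩
    · obtain ⟨bv', h1, h2⟩ := hver b c h hbc
      exact ⟨bh, bv', hh, h1, fun x y => by linear_combination h2 x y + hb' x y⟩
    · obtain ⟨bv', h1, h2⟩ := hver c b h hbc.symm
      exact ⟨bh, bv', hh, h1, fun x y => by linear_combination h2 x y + hb' x y⟩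

/-- The number modulo two of horizontal edges of a chain met by a vertical ray going down from
the unit square with lower left corner `(i, j)`. -/
noncomputable def columnSum (bh : ℤ → ℤ → ZMod 2) (i j : ℤ) : ZMod 2 := ∑ l ∈ Finset.Icc 0 j, bh i l

theorem sum_Icc_zero_eq_add {g : ℤ → ZMod 2} {j : ℤ} (hj : 0 ≤ j) :
    ∑ l ∈ Finset.Icc 0 j, g l = ∑ l ∈ Finset.Icc 0 (j - 1), g l + g j := by
  have h : Finset.Icc 0 j = insert j (Finset.Icc 0 (j - 1)) := by
    ext l; simp only [Finset.mem_insert, Finset.mem_Icc]; omega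
  rw [h, Finset.sum_insert (by simp), add_comm]

theorem columnSum_eq_add (bh : ℤ → ℤ → ZMod 2) {i j : ℤ} (hj : 0 ≤ j) :
    columnSum bh i j = columnSum bh i (j - 1) + bh i j := sum_Icc_zero_eq_add hj

theorem columnSum_of_neg (bh : ℤ → ℤ → ZMod 2) {i j : ℤ} (hj : j < 0) : columnSum bh i j = 0 := by
  rw [columnSum, Finset.Icc_eq_empty (by omega), Finset.sum_empty]

/-- Two neighbouring column sums differ by the vertical edge between them, corrected by the
boundary of the chain. -/
theorem columnSum_add_columnSum {bh bv : ℤ → ℤ → ZMod 2} {d : ℤ → ZMod 2} {i j : ℤ} (hj : -1 ≤ j)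
    (hd : ∀ l, 0 ≤ l → l ≤ j → bh (i - 1) l + bh i l + bv i (l - 1) + bv i l = d l)
    (h0 : bv i (-1) = 0) :
    columnSum bh i j + columnSum bh (i - 1) j = bv i j + ∑ l ∈ Finset.Icc 0 j, d l := by
  induction j, hj using Int.leInduction with
  | base => simp [columnSum, h0]
  | succ j hj ih =>
    have ih' := ih fun l h1 h2 => hd l h1 (by omega)
    have h := hd (j + 1) (by omega) le_rfl
    rw [columnSum_eq_add bh (i := i) (j := j + 1) (by omega),
      columnSum_eq_add bh (i := i - 1) (j := j + 1) (by omega),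
      sum_Icc_zero_eq_add (j := j + 1) (by omega)]
    simp only [add_sub_cancel_right] at h ⊢
    linear_combination ih' + h - CharTwo.add_self_eq_zero (bv i (j + 1))

/-! ### Planarity -/

theorem openAdj_top {u v : ℤ × ℤ} : OpenAdj ⊤ u v ↔ IsLatticeEdge s(u, v) :=
  ⟨fun h => h.1, fun h => ⟨h, rfl⟩⟩

/-- Paths that are forced to cross: if a path in `X` starts on the line `x = a - 1`, a disjoint
path in `Y` ends on the line `y = N`, to the left of the end of the first path, then the vertical
line going down from the start of the second path crosses the first path. -/
theorem exists_mem_below_of_disjoint {X Y : Set (ℤ × ℤ)} {a N : ℤ} {u v s t : ℤ × ℤ}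
    (hp : Joined ⊤ X u v) (hq : Joined ⊤ Y s t) (hXY : Disjoint X Y)
    (hX : ∀ w ∈ X, a - 1 ≤ w.1 ∧ 0 ≤ w.2 ∧ w.2 ≤ N) (hu : u.1 = a - 1)
    (hY : ∀ w ∈ Y, a ≤ w.1 ∧ 0 ≤ w.2 ∧ w.2 ≤ N) (hv : ∀ w ∈ Y, w.1 = v.1 → w.2 < v.2)
    (ht : t.2 = N) (htv : t.1 < v.1) :
    ∃ l, 0 ≤ l ∧ l ≤ s.2 ∧ (s.1, l) ∈ X ∧ (s.1 + 1, l) ∈ X := by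
  obtain ⟨bh, bv, hbh, hbv, hb⟩ := hp.exists_chain
  have hbh0 : ∀ x y, ((x, y) ∉ X ∨ (x + 1, y) ∉ X) → bh x y = 0 := by
    intro x y h
    by_contra hne
    have := hbh x y hne
    exact h.elim (· this.1) (· this.2.1)
  have hbv0 : ∀ x y, ((x, y) ∉ X ∨ (x, y + 1) ∉ X) → bv x y = 0 := by
    intro x y h
    by_contra hne
    have := hbv x y hne
    exact h.elim (· this.1) (· this.2.1)
  have hrow : ∀ i j, -1 ≤ j → columnSum bh i j + columnSum bh (i - 1) j = bv i j +
      ∑ l ∈ Finset.Icc 0 j, (vertexIndicator u (i, l) + vertexIndicator v (i, l)) :=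
    fun i j hj => columnSum_add_columnSum hj (fun l _ _ => hb i l)
      (hbv0 _ _ (Or.inl fun h => by have := (hX _ h).2.1; simp at this))
  have hYX : ∀ w ∈ Y, w ∉ X := fun w hw hw' => Set.disjoint_left.1 hXY hw' hw
  have hut := hX u hp.1
  have htY := hY t hq.right_mem
  have htop : ∀ i, a - 1 ≤ i → i < v.1 → columnSum bh i N = 1 := by
    intro i hi
    induction i, hi using Int.leInduction with
    | base =>
      intro hlt
      have h := hrow (a - 1) N (by omega)
      have h1 : columnSum bh (a - 1 - 1) N = 0 :=
        Finset.sum_eq_zero fun l _ => hbh0 _ _ (Or.inl fun h => by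
          have := (hX _ h).1; simp at this)
      have h2 : bv (a - 1) N = 0 := hbv0 _ _ (Or.inr fun h => by
        have := (hX _ h).2.2; simp at this)
      have h3 : ∑ l ∈ Finset.Icc 0 N,
          (vertexIndicator u (a - 1, l) + vertexIndicator v (a - 1, l)) = 1 := by
        rw [Finset.sum_eq_single_of_mem u.2 (Finset.mem_Icc.2 ⟨hut.2.1, hut.2.2⟩)]
        · simp [vertexIndicator, Prod.ext_iff, hu, hlt.ne']
        · intro l _ hl
          simp [vertexIndicator, Prod.ext_iff, hu, hlt.ne', hl.symm]
      rw [h1, h2, h3] at h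
      simpa using h
    | succ i hi ih =>
      intro hlt
      have h := hrow (i + 1) N (by omega)
      have h2 : bv (i + 1) N = 0 := hbv0 _ _ (Or.inr fun h => by
        have := (hX _ h).2.2; simp at this)
      have h3 : ∑ l ∈ Finset.Icc 0 N,
          (vertexIndicator u (i + 1, l) + vertexIndicator v (i + 1, l)) = 0 := by
        refine Finset.sum_eq_zero fun l _ => ?_
        have h4 : ¬ u.1 = i + 1 := by omega
        simp [vertexIndicator, Prod.ext_iff, hlt.ne', h4]
      rw [add_sub_cancel_right, ih (by omega), h2, h3] at h
      linear_combination h - CharTwo.add_self_eq_zero (1 : ZMod 2)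
  have hright : ∀ w w' : ℤ × ℤ, w' = (w.1 + 1, w.2) → w ∈ Y → w' ∈ Y →
      columnSum bh w.1 w.2 = columnSum bh w'.1 w'.2 := by
    rintro ⟨x, y⟩ w' rfl hw hw'
    have hy := hY _ hw
    have h := hrow (x + 1) y (by simp at hy; omega)
    have h2 : bv (x + 1) y = 0 := hbv0 _ _ (Or.inl (hYX _ hw'))
    have h3 : ∑ l ∈ Finset.Icc 0 y,
        (vertexIndicator u (x + 1, l) + vertexIndicator v (x + 1, l)) = 0 := by
      refine Finset.sum_eq_zero fun l hl => ?_
      have h4 : ¬ u.1 = x + 1 := by simp at hy; omega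
      have h5 : ¬ (v.1 = x + 1 ∧ v.2 = l) := by
        rintro ⟨h5, h6⟩
        have := hv _ hw' h5.symm
        have := (Finset.mem_Icc.1 hl).2
        simp at *
        omega
      simp [vertexIndicator, Prod.ext_iff, h4, h5]
    rw [add_sub_cancel_right, h2, h3] at h
    dsimp only
    linear_combination CharTwo.add_self_eq_zero (columnSum bh x y) - h
  have hup : ∀ w w' : ℤ × ℤ, w' = (w.1, w.2 + 1) → w ∈ Y → w' ∈ Y →
      columnSum bh w.1 w.2 = columnSum bh w'.1 w'.2 := by
    rintro ⟨x, y⟩ w' rfl hw hw'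
    have hy := hY _ hw
    dsimp only
    rw [columnSum_eq_add (j := y + 1) bh (by simp at hy; omega),
      hbh0 x (y + 1) (Or.inl (hYX _ hw'))]
    simp
  have hconst : columnSum bh s.1 s.2 = columnSum bh t.1 t.2 := by
    obtain ⟨-, hq⟩ := hq
    clear ht htv htY
    induction hq with
    | refl => rfl
    | @tail b c _ hbc ih =>
      rw [ih]
      rcases hbc.2.2.eq_add with h | h | h | h
      · exact hright _ _ h hbc.1 hbc.2.1
      · exact (hright _ _ h hbc.2.1 hbc.1).symm
      · exact hup _ _ h hbc.1 hbc.2.1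
      · exact (hup _ _ h hbc.2.1 hbc.1).symm
  rw [ht, htop t.1 (by omega) htv] at hconst
  obtain ⟨l, hl, hl'⟩ := Finset.exists_ne_zero_of_sum_ne_zero
    (show ∑ l ∈ Finset.Icc 0 s.2, bh s.1 l ≠ 0 from fun h => by
      rw [columnSum, h] at hconst; exact zero_ne_one hconst)
  rw [Finset.mem_Icc] at hl
  have := hbh _ _ hl'
  exact ⟨l, hl.1, hl.2, this.1, this.2.1⟩

/-- The rectangle `[a, b] × [0, N]`. -/
def rect (a b N : ℤ) : Set (ℤ × ℤ) := {w | a ≤ w.1 ∧ w.1 ≤ b ∧ 0 ≤ w.2 ∧ w.2 ≤ N}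

theorem finite_rect (a b N : ℤ) : (rect a b N).Finite := by
  refine ((Set.finite_Icc a b).prod (Set.finite_Icc 0 N)).subset ?_
  rintro w ⟨h1, h2, h3, h4⟩
  exact ⟨⟨h1, h2⟩, h3, h4⟩

theorem isLatticeEdge_right (x y : ℤ) : IsLatticeEdge s((x, y), (x + 1, y)) := by
  simp [isLatticeEdge_iff]

/-- In a rectangle, a left-right path meets every bottom-top path. -/
theorem joined_of_left_right_of_bottom_top {ω : PercConfig} {a b N : ℤ} {u v s t : ℤ × ℤ}
    (hp : Joined ω (rect a b N) u v) (hq : Joined ω (rect a b N) s t) (hu : u.1 = a)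
    (hv : v.1 = b) (hs : s.2 = 0) (ht : t.2 = N) : Joined ω (rect a b N) u s := by
  by_contra hus
  set C : Set (ℤ × ℤ) := {x | Joined ω (rect a b N) u x} with hC
  set X : Set (ℤ × ℤ) := insert (a - 1, u.2) (insert (b + 1, v.2) C) with hX
  have hCX : C ⊆ X := fun x hx => Or.inr (Or.inr hx)
  have hCr : ∀ x ∈ C, x ∈ rect a b N := fun x hx => Joined.right_mem hx
  have hur := hp.1
  have hvr := hp.right_mem
  have hp' : Joined ⊤ X u v := hp.within_cluster.mono le_top hCX
  have hp1 : Joined ⊤ X (a - 1, u.2) u :=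
    (Joined.refl (Or.inl rfl)).tail ⟨Or.inl rfl, hp'.1, openAdj_top.2 (by
      have := isLatticeEdge_right (a - 1) u.2
      rwa [sub_add_cancel, show (a, u.2) = u from Prod.ext hu.symm rfl] at this)⟩
  have hp2 : Joined ⊤ X (a - 1, u.2) (b + 1, v.2) :=
    (hp1.trans hp').tail ⟨hp'.right_mem, Or.inr (Or.inl rfl), openAdj_top.2 (by
      have := isLatticeEdge_right b v.2
      rwa [show (b, v.2) = v from Prod.ext hv.symm rfl] at this)⟩
  have hY : ∀ x ∈ {x | Joined ω (rect a b N) s x}, x ∈ rect a b N :=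
    fun x hx => Joined.right_mem hx
  obtain ⟨l, hl0, hl1, hl2, -⟩ := exists_mem_below_of_disjoint (a := a) (N := N) hp2
    (hq.within_cluster.mono le_top subset_rfl) (by
      refine Set.disjoint_left.2 ?_
      rintro x (rfl | rfl | hx) hx'
      · have := (hY _ hx').1; simp at this
      · have := (hY _ hx').2.1; simp at this
      · exact hus (Joined.trans hx (Joined.symm hx')))
    (by
      rintro x (rfl | rfl | hx)
      · exact ⟨le_rfl, hur.2.2⟩
      · exact ⟨by have := hur.1; have := hur.2.1; simp; omega, hvr.2.2⟩
      · have := hCr x hx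
        exact ⟨by have := this.1; omega, this.2.2⟩)
    rfl (fun x hx => ⟨(hY x hx).1, (hY x hx).2.2⟩)
    (fun x hx h => by have := (hY x hx).2.1; simp at h; omega) ht
    (by have := (hY t hq).2.1; simp; omega)
  have hl : (s.1, l) = s := Prod.ext rfl (by simp; omega)
  rw [hl] at hl2
  have hsr := hq.1
  rcases hl2 with h | h | h
  · have := hsr.1; rw [h] at this; simp at this
  · have := hsr.2.1; rw [h] at this; simp at this
  · exact hus h

/-- In a rectangle, a path from the left side to the top meets every path from the right side to
the top which ends further to the left. -/
theorem joined_of_left_top_of_right_top {ω : PercConfig} {a b N : ℤ} {u v s t : ℤ × ℤ}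
    (hp : Joined ω (rect a b N) u v) (hq : Joined ω (rect a b N) s t) (hu : u.1 = a)
    (hv : v.2 = N) (hs : s.1 = b) (ht : t.2 = N) (htv : t.1 ≤ v.1) :
    Joined ω (rect a b N) u s := by
  by_contra hus
  set C : Set (ℤ × ℤ) := {x | Joined ω (rect a b N) u x} with hC
  set X : Set (ℤ × ℤ) := insert (a - 1, u.2) C with hX
  have hCX : C ⊆ X := fun x hx => Or.inr hx
  have hCr : ∀ x ∈ C, x ∈ rect a b N := fun x hx => Joined.right_mem hx
  have hur := hp.1
  have hp' : Joined ⊤ X u v := hp.within_cluster.mono le_top hCX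
  have hp1 : Joined ⊤ X (a - 1, u.2) v :=
    ((Joined.refl (Or.inl rfl)).tail ⟨Or.inl rfl, hp'.1, openAdj_top.2 (by
      have := isLatticeEdge_right (a - 1) u.2
      rwa [sub_add_cancel, show (a, u.2) = u from Prod.ext hu.symm rfl] at this)⟩).trans hp'
  have hY : ∀ x ∈ {x | Joined ω (rect a b N) s x}, x ∈ rect a b N :=
    fun x hx => Joined.right_mem hx
  have hdisj : Disjoint C {x | Joined ω (rect a b N) s x} :=
    Set.disjoint_left.2 fun x hx hx' => hus (Joined.trans hx (Joined.symm hx'))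
  have hne : t.1 ≠ v.1 := fun h => by
    have h' : t = v := Prod.ext h (by rw [ht, hv])
    exact Set.disjoint_left.1 hdisj (show v ∈ C from hp) (h' ▸ hq)
  obtain ⟨l, hl0, hl1, -, hl2⟩ := exists_mem_below_of_disjoint (a := a) (N := N) hp1
    (hq.within_cluster.mono le_top subset_rfl) (by
      refine Set.disjoint_left.2 ?_
      rintro x (rfl | hx) hx'
      · have := (hY _ hx').1; simp at this
      · exact Set.disjoint_left.1 hdisj hx hx')
    (by
      rintro x (rfl | hx)
      · exact ⟨le_rfl, hur.2.2⟩
      · have := hCr x hx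
        exact ⟨by have := this.1; omega, this.2.2⟩)
    rfl (fun x hx => ⟨(hY x hx).1, (hY x hx).2.2⟩)
    (fun x hx h => by
      refine lt_of_le_of_ne (by rw [hv]; exact (hY x hx).2.2.2) fun h' => ?_
      exact Set.disjoint_left.1 hdisj (show v ∈ C from hp) (Prod.ext h h' ▸ hx)) ht
    (lt_of_le_of_ne htv hne)
  have hsr := hq.1
  rcases hl2 with h | h
  · have h1 := hsr.1
    have h2 := congrArg Prod.fst h
    simp at h2
    omega
  · have := (hCr _ h).2.1
    simp at this
    omega

/-! ### Cuts -/

/-- The unit squares with lower left corner in `[0, N - 1] × [-1, N - 1]`, named by that corner. -/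
noncomputable def box (N : ℤ) : Finset (ℤ × ℤ) := Finset.Ico 0 N ×ˢ Finset.Ico (-1) N

theorem mem_box {N : ℤ} {f : ℤ × ℤ} :
    f ∈ box N ↔ (0 ≤ f.1 ∧ f.1 < N) ∧ -1 ≤ f.2 ∧ f.2 < N := by
  simp [box]

/-- A set of unit squares containing the row of squares below `[0, N] × [0, N]`, whose boundary
inside this square consists of open edges. -/
structure IsCut (N : ℤ) (ω : PercConfig) (A : Finset (ℤ × ℤ)) : Prop where
  subset_box : A ⊆ box N
  bottom_mem : ∀ i, 0 ≤ i → i < N → (i, -1) ∈ A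
  openAdj_right : ∀ i j, 0 ≤ i → i < N → 0 ≤ j → ¬((i, j - 1) ∈ A ↔ (i, j) ∈ A) →
    OpenAdj ω (i, j) (i + 1, j)
  openAdj_up : ∀ i j, 1 ≤ i → i < N → ¬((i - 1, j) ∈ A ↔ (i, j) ∈ A) →
    OpenAdj ω (i, j) (i, j + 1)

theorem IsCut.inter {N : ℤ} {ω : PercConfig} {A B : Finset (ℤ × ℤ)} (hA : IsCut N ω A)
    (hB : IsCut N ω B) : IsCut N ω (A ∩ B) where
  subset_box := Finset.inter_subset_left.trans hA.subset_box
  bottom_mem i hi hi' := Finset.mem_inter.2 ⟨hA.bottom_mem i hi hi', hB.bottom_mem i hi hi'⟩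
  openAdj_right i j hi hi' hj h := by
    by_contra hne
    have h1 := not_imp_comm.1 (hA.openAdj_right i j hi hi' hj) hne
    have h2 := not_imp_comm.1 (hB.openAdj_right i j hi hi' hj) hne
    simp [h1, h2] at h
  openAdj_up i j hi hi' h := by
    by_contra hne
    have h1 := not_imp_comm.1 (hA.openAdj_up i j hi hi') hne
    have h2 := not_imp_comm.1 (hB.openAdj_up i j hi hi') hne
    simp [h1, h2] at h

/-- A chain modulo two without boundary inside `[0, N] × [0, N]` which crosses the left column an
odd number of times bounds a set of unit squares containing the bottom row. -/
theorem exists_boundary_subset_chain {N : ℤ} (hN : 0 < N) {bh bv : ℤ → ℤ → ZMod 2}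
    (hb : ∀ i l, 1 ≤ i → i < N → 0 ≤ l → l ≤ N →
      bh (i - 1) l + bh i l + bv i (l - 1) + bv i l = 0)
    (hv0 : ∀ i, 1 ≤ i → i < N → bv i (-1) = 0) (hvN : ∀ i, 1 ≤ i → i < N → bv i N = 0)
    (hsum : columnSum bh 0 N = 1) :
    ∃ A ⊆ box N, (∀ i, 0 ≤ i → i < N → (i, -1) ∈ A) ∧
      (∀ i j, 0 ≤ i → i < N → 0 ≤ j → ¬((i, j - 1) ∈ A ↔ (i, j) ∈ A) → bh i j ≠ 0) ∧
      ∀ i j, 1 ≤ i → i < N → ¬((i - 1, j) ∈ A ↔ (i, j) ∈ A) → bv i j ≠ 0 := by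
  classical
  have hcol : ∀ i j, 1 ≤ i → i < N → -1 ≤ j → j ≤ N →
      columnSum bh i j + columnSum bh (i - 1) j = bv i j := by
    intro i j hi hi' hj hj'
    have := columnSum_add_columnSum (d := 0) hj
      (fun l h0 h1 => hb i l hi hi' h0 (by omega)) (hv0 i hi hi')
    simpa using this
  have htop : ∀ i, 0 ≤ i → i < N → columnSum bh i N = 1 := by
    intro i hi
    induction i, hi using Int.leInduction with
    | base => exact fun _ => hsum
    | succ i hi ih =>
      intro h
      have := hcol (i + 1) N (by omega) h (by omega) le_rfl
      rw [add_sub_cancel_right, ih (by omega), hvN _ (by omega) h] at this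
      linear_combination this - CharTwo.add_self_eq_zero (1 : ZMod 2)
  have hmem : ∀ i j, 0 ≤ i → i < N → -1 ≤ j → j ≤ N →
      ((i, j) ∈ (box N).filter (fun f => columnSum bh f.1 f.2 = 0) ↔ columnSum bh i j = 0) := by
    intro i j hi hi' hj hj'
    rw [Finset.mem_filter, mem_box]
    refine ⟨fun h => h.2, fun h => ⟨⟨⟨hi, hi'⟩, hj, lt_of_le_of_ne hj' ?_⟩, h⟩⟩
    rintro rfl
    rw [htop i hi hi'] at h
    exact one_ne_zero h
  refine ⟨(box N).filter (fun f => columnSum bh f.1 f.2 = 0), Finset.filter_subset _ _,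
    fun i hi hi' => ?_, fun i j hi hi' hj h => ?_, fun i j hi hi' h => ?_⟩
  · rw [hmem i (-1) hi hi' le_rfl (by omega)]
    exact columnSum_of_neg _ (by omega)
  · rcases le_or_gt j N with hjN | hjN
    · rw [hmem _ _ hi hi' (by omega) (by omega), hmem _ _ hi hi' (by omega) hjN,
        columnSum_eq_add bh hj] at h
      intro h'
      simp [h'] at h
    · refine (h ?_).elim
      simp only [Finset.mem_filter, mem_box]
      exact iff_of_false (fun h => by omega) (fun h => by omega)
  · by_cases hj : -1 ≤ j ∧ j ≤ N
    · rw [hmem _ _ (by omega) (by omega) hj.1 hj.2, hmem _ _ (by omega) hi' hj.1 hj.2] at h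
      intro h'
      have := hcol i j hi hi' hj.1 hj.2
      rw [h', CharTwo.add_eq_zero] at this
      simp [this] at h
    · refine (h ?_).elim
      simp only [Finset.mem_filter, mem_box]
      exact iff_of_false (fun h => by omega) (fun h => by omega)

/-- The vertex `v` is a corner of the unit square with lower left corner `f`. -/
def Around (v f : ℤ × ℤ) : Prop := (f.1 = v.1 - 1 ∨ f.1 = v.1) ∧ (f.2 = v.2 - 1 ∨ f.2 = v.2)

/-- A left-right crossing of `[0, N] × [0, N]` yields a cut. -/
theorem Joined.exists_isCut {ω : PercConfig} {N : ℤ} (hN : 0 < N) {u v : ℤ × ℤ}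
    (h : Joined ω (rect 0 N N) u v) (hu : u.1 = 0) (hv : v.1 = N) : ∃ A, IsCut N ω A := by
  obtain ⟨bh, bv, hbh, hbv, hb⟩ := h.exists_chain
  have hur := h.1
  have hvN : ∀ i, bv i N = 0 := by
    intro i
    by_contra hne
    have := (hbv _ _ hne).2.1.2.2.2
    simp at this
  have hv0 : ∀ i, bv i (-1) = 0 := by
    intro i
    by_contra hne
    have := (hbv _ _ hne).1.2.2.1
    simp at this
  have hsum : columnSum bh 0 N = 1 := by
    have h1 := columnSum_add_columnSum (bh := bh) (bv := bv) (i := 0) (j := N) (by omega)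
      (fun l _ _ => hb 0 l) (hv0 0)
    have h2 : columnSum bh (0 - 1) N = 0 := Finset.sum_eq_zero fun l _ => by
      by_contra hne
      have := (hbh _ _ hne).1.1
      simp at this
    have h3 : ∑ l ∈ Finset.Icc 0 N, (vertexIndicator u (0, l) + vertexIndicator v (0, l)) = 1 := by
      rw [Finset.sum_eq_single_of_mem u.2 (Finset.mem_Icc.2 ⟨hur.2.2.1, hur.2.2.2⟩)]
      · simp [vertexIndicator, Prod.ext_iff, hu, hv, hN.ne']
      · intro l _ hl
        simp [vertexIndicator, Prod.ext_iff, hu, hv, hN.ne', hl.symm]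
    rw [h2, h3, hvN] at h1
    simpa using h1
  obtain ⟨A, h1, h2, h3, h4⟩ := exists_boundary_subset_chain hN (bh := bh) (bv := bv)
    (fun i l hi hi' _ _ => by
      rw [hb]
      have h5 : u.1 ≠ i := by omega
      have h6 : v.1 ≠ i := by omega
      simp [vertexIndicator, Prod.ext_iff, h5, h6])
    (fun i _ _ => hv0 i) (fun i _ _ => hvN i) hsum
  exact ⟨A, h1, h2, fun i j hi hi' hj h => (hbh _ _ (h3 i j hi hi' hj h)).2.2,
    fun i j hi hi' h => (hbv _ _ (h4 i j hi hi' h)).2.2⟩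

theorem exists_minimal_isCut {N : ℤ} {ω : PercConfig} {A : Finset (ℤ × ℤ)} (h : IsCut N ω A) :
    ∃ d, Minimal (IsCut N ω) d := by
  obtain ⟨d, -, hd⟩ := exists_minimal_le_of_wellFoundedLT (IsCut N ω) A h
  exact ⟨d, hd⟩

theorem minimal_isCut_unique {N : ℤ} {ω : PercConfig} {d d' : Finset (ℤ × ℤ)}
    (h : Minimal (IsCut N ω) d) (h' : Minimal (IsCut N ω) d') : d = d' := by
  have hc := h.prop.inter h'.prop
  exact le_antisymm ((h.2 hc Finset.inter_subset_left).trans Finset.inter_subset_right)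
    ((h'.2 hc Finset.inter_subset_right).trans Finset.inter_subset_left)

/-- The vertex `v` is a corner of a unit square of `d`. -/
def Touches (d : Finset (ℤ × ℤ)) (v : ℤ × ℤ) : Prop := ∃ f ∈ d, Around v f

/-- The edges of `[0, N] × [0, N]` both of whose endpoints are corners of squares of `d`. -/
def touchingEdges (N : ℤ) (d : Finset (ℤ × ℤ)) : Set LatticeEdge :=
  {e | ∀ v ∈ e.1, v ∈ rect 0 N N ∧ Touches d v}

theorem IsCut.congr {N : ℤ} {ω ω' : PercConfig} {A d : Finset (ℤ × ℤ)} (h : IsCut N ω A)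
    (hAd : A ⊆ d) (hω : ∀ e ∈ touchingEdges N d, ω e = ω' e) : IsCut N ω' A where
  subset_box := h.subset_box
  bottom_mem := h.bottom_mem
  openAdj_right i j hi hi' hj hne := by
    refine (h.openAdj_right i j hi hi' hj hne).congr fun e he => hω e fun v hv => ?_
    obtain ⟨j', hj', hA⟩ : ∃ j', (j' = j - 1 ∨ j' = j) ∧ (i, j') ∈ A := by
      by_contra! hcon
      exact hne (iff_of_false (hcon _ (Or.inl rfl)) (hcon _ (Or.inr rfl)))
    have hb := mem_box.1 (h.subset_box hA)
    simp only at hb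
    rw [he, Sym2.mem_iff] at hv
    rcases hv with rfl | rfl
    · exact ⟨⟨hi, hi'.le, hj, by simp only; omega⟩, _, hAd hA, Or.inr rfl, hj'⟩
    · exact ⟨⟨by simp only; omega, by simp only; omega, hj, by simp only; omega⟩, _, hAd hA,
        Or.inl (by simp), hj'⟩
  openAdj_up i j hi hi' hne := by
    refine (h.openAdj_up i j hi hi' hne).congr fun e he => hω e fun v hv => ?_
    obtain ⟨i', hi1, hA⟩ : ∃ i', (i' = i - 1 ∨ i' = i) ∧ (i', j) ∈ A := by
      by_contra! hcon
      exact hne (iff_of_false (hcon _ (Or.inl rfl)) (hcon _ (Or.inr rfl)))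
    have hb := mem_box.1 (h.subset_box hA)
    simp only at hb
    have hj : 0 ≤ j := by
      by_contra hj
      have hj1 : j = -1 := by omega
      subst hj1
      exact hne (iff_of_true (h.bottom_mem _ (by omega) (by omega))
        (h.bottom_mem _ (by omega) (by omega)))
    rw [he, Sym2.mem_iff] at hv
    rcases hv with rfl | rfl
    · exact ⟨⟨by simp only; omega, hi'.le, hj, by simp only; omega⟩, _, hAd hA, hi1, Or.inr rfl⟩
    · exact ⟨⟨by simp only; omega, hi'.le, by simp only; omega, by simp only; omega⟩, _, hAd hA,
        hi1, Or.inl (by simp)⟩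

/-- The event that `d` is the minimal cut. -/
def minCutEvent (N : ℤ) (d : Finset (ℤ × ℤ)) : Set PercConfig := {ω | Minimal (IsCut N ω) d}

theorem determinedBy_minCutEvent (N : ℤ) (d : Finset (ℤ × ℤ)) :
    DeterminedBy (minCutEvent N d) (touchingEdges N d) := by
  intro ω ω' hω h
  refine ⟨h.prop.congr subset_rfl hω, fun A hA hAd => ?_⟩
  exact h.2 (hA.congr hAd fun e he => (hω e he).symm) hAd

/-- The part of the boundary of the minimal cut which is joined to the left side already is the
boundary of a set of unit squares containing the cut. -/
theorem exists_boundary_joined_left {N : ℤ} (hN : 0 < N) {ω : PercConfig} {d : Finset (ℤ × ℤ)}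
    (hd : Minimal (IsCut N ω) d) :
    ∃ A ⊆ box N, d ⊆ A ∧
      (∀ i j, 0 ≤ i → i < N → 0 ≤ j → ¬((i, j - 1) ∈ A ↔ (i, j) ∈ A) →
        ¬((i, j - 1) ∈ d ↔ (i, j) ∈ d) ∧ ∃ u, u.1 = 0 ∧ Joined ω (rect 0 N N) u (i, j)) ∧
      ∀ i j, 1 ≤ i → i < N → ¬((i - 1, j) ∈ A ↔ (i, j) ∈ A) →
        ¬((i - 1, j) ∈ d ↔ (i, j) ∈ d) ∧ ∃ u, u.1 = 0 ∧ Joined ω (rect 0 N N) u (i, j) := by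
  classical
  set L : ℤ → ℤ → Prop := fun i j => ∃ u, u.1 = 0 ∧ Joined ω (rect 0 N N) u (i, j) with hL
  have hLr : ∀ i j, L i j → (i, j) ∈ rect 0 N N := by
    rintro i j ⟨u, -, h⟩; exact h.right_mem
  have hLstep : ∀ i j i' j', (i', j') ∈ rect 0 N N → OpenAdj ω (i, j) (i', j') → L i j →
      L i' j' := by
    rintro i j i' j' hr ha ⟨u, hu, h⟩; exact ⟨u, hu, h.tail ⟨h.right_mem, hr, ha⟩⟩
  set δ : ℤ → ℤ → ZMod 2 := fun i j => if (i, j) ∈ d then 1 else 0 with hδ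
  have hδne : ∀ i j i' j', δ i j + δ i' j' ≠ 0 → ¬((i, j) ∈ d ↔ (i', j') ∈ d) := by
    intro i j i' j' h h'
    simp only [hδ, h'] at h
    exact h (CharTwo.add_self_eq_zero _)
  have hδN : ∀ i, δ i N = 0 := by
    intro i
    refine if_neg fun h => ?_
    have := (mem_box.1 (hd.prop.subset_box h)).2.2
    simp at this
  have hδ0 : ∀ i, 0 ≤ i → i < N → δ i (-1) = 1 := fun i h h' => if_pos (hd.prop.bottom_mem i h h')
  set bh : ℤ → ℤ → ZMod 2 := fun i j => if L i j then δ i (j - 1) + δ i j else 0 with hbh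
  set bv : ℤ → ℤ → ZMod 2 := fun i j => if L i j then δ (i - 1) j + δ i j else 0 with hbv
  have hv0 : ∀ i, bv i (-1) = 0 := by
    intro i
    refine if_neg fun h => ?_
    have := (hLr _ _ h).2.2.1
    simp at this
  have hvN : ∀ i, bv i N = 0 := fun i => by simp [hbv, hδN]
  have hbh' : ∀ i l, 1 ≤ i → i < N → 0 ≤ l → l ≤ N →
      bh (i - 1) l = if L i l then δ (i - 1) (l - 1) + δ (i - 1) l else 0 := by
    intro i l hi hi' hl hl'
    by_cases hne : δ (i - 1) (l - 1) + δ (i - 1) l = 0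
    · simp [hbh, hne]
    · have ha := hd.prop.openAdj_right (i - 1) l (by omega) (by omega) hl (hδne _ _ _ _ hne)
      rw [sub_add_cancel] at ha
      have : L (i - 1) l ↔ L i l :=
        ⟨hLstep _ _ _ _ ⟨by simp only; omega, by simp only; omega, hl, hl'⟩ ha,
          hLstep _ _ _ _ ⟨by simp only; omega, by simp only; omega, hl, hl'⟩ ha.symm⟩
      simp only [hbh, this]
  have hbv' : ∀ i l, 1 ≤ i → i < N → 0 ≤ l → l ≤ N →
      bv i (l - 1) = if L i l then δ (i - 1) (l - 1) + δ i (l - 1) else 0 := by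
    intro i l hi hi' hl hl'
    by_cases hne : δ (i - 1) (l - 1) + δ i (l - 1) = 0
    · simp [hbv, hne]
    · have hl1 : 1 ≤ l := by
        by_contra hl1
        have : l - 1 = -1 := by omega
        rw [this, hδ0 _ (by omega) (by omega), hδ0 _ (by omega) (by omega)] at hne
        exact hne (CharTwo.add_self_eq_zero _)
      have ha := hd.prop.openAdj_up i (l - 1) hi hi' (hδne _ _ _ _ hne)
      rw [sub_add_cancel] at ha
      have : L i (l - 1) ↔ L i l :=
        ⟨hLstep _ _ _ _ ⟨by simp only; omega, by simp only; omega, hl, hl'⟩ ha,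
          hLstep _ _ _ _ ⟨by simp only; omega, by simp only; omega, by simp only; omega,
            by simp only; omega⟩ ha.symm⟩
      simp only [hbv, this]
  have hL0 : ∀ l, 0 ≤ l → l ≤ N → L 0 l := fun l h h' =>
    ⟨(0, l), rfl, Joined.refl ⟨le_rfl, hN.le, h, h'⟩⟩
  have hsum : columnSum bh 0 N = 1 := by
    have key : ∀ j, -1 ≤ j → j ≤ N → columnSum bh 0 j = 1 + δ 0 j := by
      intro j hj
      induction j, hj using Int.leInduction with
      | base =>
        intro _
        rw [columnSum_of_neg _ (by omega), hδ0 0 le_rfl hN, CharTwo.add_self_eq_zero]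
      | succ j hj ih =>
        intro h
        rw [columnSum_eq_add _ (by omega), add_sub_cancel_right, ih (by omega)]
        simp only [hbh, if_pos (hL0 (j + 1) (by omega) h), add_sub_cancel_right]
        linear_combination CharTwo.add_self_eq_zero (δ 0 j)
    rw [key N (by omega) le_rfl, hδN, add_zero]
  obtain ⟨A, h1, h2, h3, h4⟩ := exists_boundary_subset_chain hN (bh := bh) (bv := bv)
    (fun i l hi hi' hl hl' => by
      rw [hbh' i l hi hi' hl hl', hbv' i l hi hi' hl hl']
      simp only [hbh, hbv]
      split_ifs
      · linear_combination CharTwo.add_self_eq_zero (δ (i - 1) (l - 1)) +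
          CharTwo.add_self_eq_zero (δ (i - 1) l) + CharTwo.add_self_eq_zero (δ i (l - 1)) +
          CharTwo.add_self_eq_zero (δ i l)
      · simp)
    (fun i _ _ => hv0 i) (fun i _ _ => hvN i) hsum
  have h3' : ∀ i j, 0 ≤ i → i < N → 0 ≤ j → ¬((i, j - 1) ∈ A ↔ (i, j) ∈ A) →
      ¬((i, j - 1) ∈ d ↔ (i, j) ∈ d) ∧ L i j := by
    intro i j hi hi' hj h
    have := h3 i j hi hi' hj h
    simp only [hbh] at this
    split_ifs at this with hLij
    · exact ⟨hδne _ _ _ _ this, hLij⟩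
    · exact (this rfl).elim
  have h4' : ∀ i j, 1 ≤ i → i < N → ¬((i - 1, j) ∈ A ↔ (i, j) ∈ A) →
      ¬((i - 1, j) ∈ d ↔ (i, j) ∈ d) ∧ L i j := by
    intro i j hi hi' h
    have := h4 i j hi hi' h
    simp only [hbv] at this
    split_ifs at this with hLij
    · exact ⟨hδne _ _ _ _ this, hLij⟩
    · exact (this rfl).elim
  have hA : IsCut N ω A := ⟨h1, h2,
    fun i j hi hi' hj h => hd.prop.openAdj_right i j hi hi' hj (h3' i j hi hi' hj h).1,
    fun i j hi hi' h => hd.prop.openAdj_up i j hi hi' (h4' i j hi hi' h).1⟩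
  exact ⟨A, h1, (hd.2 (hd.prop.inter hA) Finset.inter_subset_left).trans Finset.inter_subset_right,
    h3', h4'⟩

/-! ### Connecting to the minimal cut -/

/-- Fold the strip `0 ≤ x ≤ 2 N` along the line `x = N`. -/
def fold (N : ℤ) (v : ℤ × ℤ) : ℤ × ℤ := (min v.1 (2 * N - v.1), v.2)

theorem fold_of_le {N : ℤ} {v : ℤ × ℤ} (h : v.1 ≤ N) : fold N v = v :=
  Prod.ext (min_eq_left (by omega)) rfl

theorem fold_reflect (N : ℤ) (v : ℤ × ℤ) : fold N (reflect (2 * N) v) = fold N v := by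
  refine Prod.ext ?_ rfl
  simp only [fold, reflect, Equiv.prodCongr_apply, Prod.map_fst, Equiv.subLeft_apply]
  omega

/-- The event that some corner of a square of `d` in the left half of `R` is joined in `R` to `T`
by a path which avoids, apart from its start, the corners of the squares of `d` and their mirror
images. -/
def avoidEvent (N : ℤ) (d : Finset (ℤ × ℤ)) (R T : Set (ℤ × ℤ)) : Set PercConfig :=
  {ω | ∃ z ∈ R, ∃ t ∈ T, z.1 ≤ N ∧ Touches d z ∧
    ReflTransGen (fun a b => OpenStep ω R a b ∧ ¬Touches d (fold N b)) z t}

theorem determinedBy_avoidEvent (N : ℤ) (d : Finset (ℤ × ℤ)) (R T : Set (ℤ × ℤ)) :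
    DeterminedBy (avoidEvent N d R T) (edgesIn R \ touchingEdges N d) := by
  rintro ω ω' hω ⟨z, hz, t, ht, hzN, hzd, h⟩
  refine ⟨z, hz, t, ht, hzN, hzd, ReflTransGen.mono (fun a b hab => ?_) _ _ h⟩
  obtain ⟨⟨ha, hb, hadj⟩, hbd⟩ := hab
  refine ⟨⟨ha, hb, hadj.congr fun e he => hω e ⟨fun w hw => ?_, fun he' => ?_⟩⟩, hbd⟩
  · rw [he, Sym2.mem_iff] at hw
    rcases hw with rfl | rfl
    exacts [ha, hb]
  · obtain ⟨h1, h2⟩ := he' b (by rw [he]; simp)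
    exact hbd (by rwa [fold_of_le h1.2.1])

/-- A path that starts in `P` has a last visit to `P`. -/
theorem exists_last_visit {α : Type*} {r : α → α → Prop} {P : α → Prop} {s t : α}
    (h : ReflTransGen r s t) (hs : P s) :
    ∃ z, ReflTransGen r s z ∧ P z ∧ ReflTransGen (fun a b => r a b ∧ ¬P b) z t := by
  induction h with
  | refl => exact ⟨s, .refl, hs, .refl⟩
  | @tail b c hb hbc ih =>
    by_cases hc : P c
    · exact ⟨c, hb.tail hbc, hc, .refl⟩
    · obtain ⟨z, h1, h2, h3⟩ := ih
      exact ⟨z, h1, h2, h3.tail ⟨hbc, hc⟩⟩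

/-- A bottom-top path in a symmetric rectangle, or its mirror image, contains a path as in
`avoidEvent`. -/
theorem joinEvent_subset_avoidEvent_union {N c : ℤ} (hc : 0 ≤ c) (hN : 0 < N)
    {d : Finset (ℤ × ℤ)} (hd : ∀ i, 0 ≤ i → i < N → (i, -1) ∈ d) {T : Set (ℤ × ℤ)}
    (hT : reflect (2 * N) ⁻¹' T = T) :
    joinEvent (rect c (2 * N - c) N) {w | w.2 = 0} T ⊆
      avoidEvent N d (rect c (2 * N - c) N) T ∪
        pullback (isLatticeAut_reflect (2 * N)) ⁻¹' avoidEvent N d (rect c (2 * N - c) N) T := by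
  rintro ω ⟨s, hs, t, ht, hsR, hst⟩
  have hs0 : Touches d (fold N s) := by
    rw [Set.mem_ofPred_eq] at hs
    obtain ⟨h1, h2, -⟩ := hsR
    rcases le_or_gt 1 (fold N s).1 with h | h
    · refine ⟨_, hd ((fold N s).1 - 1) (by omega) ?_, Or.inl rfl, Or.inl ?_⟩
      · simp only [fold]; omega
      · simp only [fold]; omega
    · refine ⟨_, hd (fold N s).1 ?_ (by omega), Or.inr rfl, Or.inl ?_⟩
      · simp only [fold]; omega
      · simp only [fold]; omega
  obtain ⟨z, hsz, hz, hzt⟩ := exists_last_visit (P := fun w => Touches d (fold N w)) hst hs0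
  have hzR : z ∈ rect c (2 * N - c) N := Joined.right_mem ⟨hsR, hsz⟩
  have hrect : ∀ w, w ∈ rect c (2 * N - c) N →
      reflect (2 * N) w ∈ rect c (2 * N - c) N := by
    rintro w ⟨h1, h2, h3, h4⟩
    simp only [rect, reflect, Equiv.prodCongr_apply, Set.mem_ofPred_eq, Prod.map_fst, Prod.map_snd,
      Equiv.subLeft_apply, Equiv.refl_apply]
    omega
  have hinv : ∀ w, reflect (2 * N) (reflect (2 * N) w) = w := fun w =>
    Prod.ext (by simp [reflect]) (by simp [reflect])
  rcases le_or_gt z.1 N with h | h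
  · refine Or.inl ⟨z, hzR, t, ht, h, ?_, hzt⟩
    rwa [fold_of_le h] at hz
  · have h' : (reflect (2 * N) z).1 ≤ N := by
      simp only [reflect, Equiv.prodCongr_apply, Prod.map_fst, Equiv.subLeft_apply]
      omega
    refine Or.inr ⟨reflect (2 * N) z, hrect z hzR, reflect (2 * N) t, ?_, h', ?_, ?_⟩
    · rw [← hT, Set.mem_preimage, hinv]; exact ht
    · rwa [← fold_of_le h', fold_reflect]
    · refine hzt.lift (reflect (2 * N)) fun a b hab =>
        ⟨⟨hrect a hab.1.1, hrect b hab.1.2.1, ?_⟩, ?_⟩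
      · rw [openAdj_pullback, hinv, hinv]
        exact hab.1.2.2
      · rw [fold_reflect]
        exact hab.2

/-- If the membership in `A` does not change across the edges at `w`, all squares around `w` are
alike. -/
theorem mem_iff_mem_of_around {N : ℤ} {A : Finset (ℤ × ℤ)} {w f g : ℤ × ℤ}
    (hh : ∀ i, (i = w.1 - 1 ∨ i = w.1) → 0 ≤ i → i < N → ((i, w.2 - 1) ∈ A ↔ (i, w.2) ∈ A))
    (hv : ∀ j, (j = w.2 - 1 ∨ j = w.2) → 1 ≤ w.1 → w.1 < N → ((w.1 - 1, j) ∈ A ↔ (w.1, j) ∈ A))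
    (hf : Around w f) (hf0 : 0 ≤ f.1) (hfN : f.1 < N) (hg : Around w g) (hg0 : 0 ≤ g.1)
    (hgN : g.1 < N) : f ∈ A ↔ g ∈ A := by
  obtain ⟨f1, f2⟩ := f
  obtain ⟨g1, g2⟩ := g
  obtain ⟨hf1, hf2⟩ := hf
  obtain ⟨hg1, hg2⟩ := hg
  simp only at *
  have step : ∀ i, (i = w.1 - 1 ∨ i = w.1) → 0 ≤ i → i < N → ∀ j, (j = w.2 - 1 ∨ j = w.2) →
      ((i, j) ∈ A ↔ (i, w.2) ∈ A) := by
    rintro i hi h0 hN j (rfl | rfl)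
    · exact hh i hi h0 hN
    · rfl
  rw [step f1 hf1 hf0 hfN f2 hf2, step g1 hg1 hg0 hgN g2 hg2]
  rcases hf1 with rfl | rfl <;> rcases hg1 with rfl | rfl
  · rfl
  · exact hv _ (Or.inr rfl) (by omega) hgN
  · exact (hv _ (Or.inr rfl) (by omega) hfN).symm
  · rfl

/-- Neighbouring vertices of `[0, N] × [0, N]` are corners of a common unit square. -/
theorem exists_around_of_openAdj {N c : ℤ} (hN : 0 < N) (hc : 0 ≤ c) {ω : PercConfig}
    {a b : ℤ × ℤ} (h : OpenStep ω (rect c (2 * N - c) N) a b) :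
    ∃ f, Around (fold N a) f ∧ Around (fold N b) f ∧ 0 ≤ f.1 ∧ f.1 < N := by
  obtain ⟨⟨ha1, ha2, -⟩, ⟨hb1, hb2, -⟩, hadj⟩ := h
  have key : ∀ a b : ℤ × ℤ, c ≤ a.1 → a.1 ≤ 2 * N - c → c ≤ b.1 → b.1 ≤ 2 * N - c →
      (b = (a.1 + 1, a.2) ∨ b = (a.1, a.2 + 1)) →
      ∃ f, Around (fold N a) f ∧ Around (fold N b) f ∧ 0 ≤ f.1 ∧ f.1 < N := by
    rintro ⟨x, y⟩ b ha1 ha2 hb1 hb2 (rfl | rfl)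
    · refine ⟨(min x (2 * N - (x + 1)), y), ⟨?_, Or.inr rfl⟩, ⟨?_, Or.inr rfl⟩, ?_, ?_⟩
      all_goals simp only [fold] at *
      all_goals omega
    · refine ⟨(min (min x (2 * N - x)) (N - 1), y), ⟨?_, Or.inr rfl⟩,
        ⟨?_, Or.inl (by simp [fold])⟩, ?_, ?_⟩
      all_goals simp only [fold] at *
      all_goals omega
  rcases hadj.eq_add with h | h | h | h
  · exact key a b ha1 ha2 hb1 hb2 (Or.inl h)
  · obtain ⟨f, h1, h2, h3⟩ := key b a hb1 hb2 ha1 ha2 (Or.inl h)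
    exact ⟨f, h2, h1, h3⟩
  · exact key a b ha1 ha2 hb1 hb2 (Or.inr h)
  · obtain ⟨f, h1, h2, h3⟩ := key b a hb1 hb2 ha1 ha2 (Or.inr h)
    exact ⟨f, h2, h1, h3⟩

/-- A path leaving the minimal cut to the top starts at a vertex joined to the left side. -/
theorem minCutEvent_inter_avoidEvent_subset {N c : ℤ} (hN : 0 < N) (hc : 0 ≤ c)
    (hcN : c ≤ N) {d : Finset (ℤ × ℤ)} {T : Set (ℤ × ℤ)} (hT : ∀ t ∈ T, t.2 = N) :
    minCutEvent N d ∩ avoidEvent N d (rect c (2 * N - c) N) T ⊆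
      joinEvent (rect 0 (2 * N - c) N) {w | w.1 = 0} T := by
  rintro ω ⟨hd, z, hzR, t, ht, hzN, hzd, h⟩
  obtain ⟨A, hAbox, hdA, hAh, hAv⟩ := exists_boundary_joined_left hN hd
  have hzQ : z ∈ rect 0 N N := ⟨by have := hzR.1; omega, hzN, hzR.2.2⟩
  suffices hL : ∃ u, u.1 = 0 ∧ Joined ω (rect 0 N N) u z by
    obtain ⟨u, hu, huz⟩ := hL
    refine ⟨u, hu, t, ht, (huz.mono le_rfl ?_).trans ⟨?_, ReflTransGen.mono ?_ _ _ h⟩⟩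
    · rintro w ⟨h1, h2, h3⟩
      exact ⟨h1, by omega, h3⟩
    · exact ⟨hzQ.1, hzR.2⟩
    · intro a b hab
      refine hab.1.mono le_rfl ?_
      rintro w ⟨h1, h2⟩
      exact ⟨hc.trans h1, h2⟩
  by_contra hL
  have hstart : ∃ f, Around (fold N z) f ∧ 0 ≤ f.1 ∧ f.1 < N ∧ f ∉ A := by
    have htR : t ∈ rect c (2 * N - c) N :=
      Joined.right_mem (ω := ω) ⟨hzR, ReflTransGen.mono (fun _ _ h => h.1) _ _ h⟩
    clear hzR hzN hzd hzQ hL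
    induction h using ReflTransGen.head_induction_on with
    | refl =>
      have htN := hT t ht
      obtain ⟨ht1, ht2, -⟩ := htR
      refine ⟨(min (fold N t).1 (N - 1), N), ⟨?_, ?_⟩, ?_, ?_, fun h => ?_⟩
      · simp only [fold]; omega
      · simp only [fold]; omega
      · simp only [fold]; omega
      · simp only [fold]; omega
      · have := (mem_box.1 (hAbox h)).2.2
        simp at this
    | @head a b hab hbt ih =>
      obtain ⟨f, hf, hf0, hfN, hfA⟩ := ih
      obtain ⟨g, hga, hgb, hg0, hgN⟩ := exists_around_of_openAdj hN hc hab.1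
      refine ⟨g, hga, hg0, hgN, fun h => hfA ?_⟩
      have hw2 : 0 ≤ (fold N b).2 := hab.1.2.1.2.2.1
      refine (mem_iff_mem_of_around (N := N) (fun i hi h0 h1 => ?_) (fun j hj h0 h1 => ?_)
        hf hf0 hfN hgb hg0 hgN).2 h
      · by_contra hne
        refine (hAh i _ h0 h1 hw2 hne).1 (iff_of_false (fun h => ?_) (fun h => ?_))
        · exact hab.2 ⟨_, h, hi, Or.inl rfl⟩
        · exact hab.2 ⟨_, h, hi, Or.inr rfl⟩
      · by_contra hne
        refine (hAv _ j h0 h1 hne).1 (iff_of_false (fun h => ?_) (fun h => ?_))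
        · exact hab.2 ⟨_, h, Or.inl rfl, hj⟩
        · exact hab.2 ⟨_, h, Or.inr rfl, hj⟩
  obtain ⟨f, hf, hf0, hfN, hfA⟩ := hstart
  rw [fold_of_le hzN] at hf
  obtain ⟨g, hgd, hg⟩ := hzd
  have hgbox := (mem_box.1 (hd.prop.subset_box hgd)).1
  refine hfA ((mem_iff_mem_of_around (N := N) (fun i hi h0 h1 => ?_) (fun j hj h0 h1 => ?_)
    hf hf0 hfN hg hgbox.1 hgbox.2).2 (hdA hgd))
  · by_contra hne
    obtain ⟨h2, u, hu, huz⟩ := hAh i _ h0 h1 hzQ.2.2.1 hne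
    rcases hi with rfl | rfl
    · have ha := hd.prop.openAdj_right _ _ h0 h1 hzQ.2.2.1 h2
      rw [sub_add_cancel] at ha
      exact hL ⟨u, hu, huz.tail ⟨huz.right_mem, hzQ, ha⟩⟩
    · exact hL ⟨u, hu, huz⟩
  · by_contra hne
    obtain ⟨h2, u, hu, huz⟩ := hAv _ j h0 h1 hne
    rcases hj with rfl | rfl
    · have ha := hd.prop.openAdj_up _ _ h0 h1 h2
      rw [sub_add_cancel] at ha
      exact hL ⟨u, hu, huz.tail ⟨huz.right_mem, hzQ, ha⟩⟩
    · exact hL ⟨u, hu, huz⟩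

/-! ### Crossing probabilities -/

theorem joinEvent_mono {R R' A A' B B' : Set (ℤ × ℤ)} (hR : R ⊆ R') (hA : A ⊆ A')
    (hB : B ⊆ B') : joinEvent R A B ⊆ joinEvent R' A' B' := by
  rintro ω ⟨u, hu, v, hv, h⟩
  exact ⟨u, hA hu, v, hB hv, h.mono le_rfl hR⟩

theorem edgesIn_mono {R R' : Set (ℤ × ℤ)} (h : R ⊆ R') : edgesIn R ⊆ edgesIn R' :=
  fun _ he v hv => h (he v hv)

theorem rect_subset_rect {a b a' b' N : ℤ} (ha : a' ≤ a) (hb : b ≤ b') :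
    rect a b N ⊆ rect a' b' N :=
  fun _ h => ⟨ha.trans h.1, h.2.1.trans hb, h.2.2⟩

section Probability

variable {p : ℝ} {μ : Measure PercConfig} [IsProbabilityMeasure μ]

open Classical in
/-- Given a left-right crossing of `[0, N] × [0, N]`, a path from the bottom of a symmetric
rectangle to a symmetric target is joined with probability at least one half to the left side. -/
theorem measureReal_mul_le_two_mul_joinEvent (hp : p ∈ Set.Ioo (0 : ℝ) 1)
    (hμ : IsBernoulliProduct p μ) {N c : ℤ} (hN : 0 < N) (hc : 0 ≤ c) (hcN : c ≤ N)
    {T : Set (ℤ × ℤ)} (hT : ∀ t ∈ T, t.2 = N) (hT' : reflect (2 * N) ⁻¹' T = T) :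
    μ.real (joinEvent (rect 0 N N) {w | w.1 = 0} {w | w.1 = N}) *
        μ.real (joinEvent (rect c (2 * N - c) N) {w | w.2 = 0} T) ≤
      2 * μ.real (joinEvent (rect 0 (2 * N - c) N) {w | w.1 = 0} T) := by
  set D := (box N).powerset.filter fun d => ∀ i, 0 ≤ i → i < N → (i, -1) ∈ d with hD
  set R := rect c (2 * N - c) N
  have hRfin : (edgesIn R).Finite := finite_edgesIn (finite_rect _ _ _)
  have htouch : ∀ d, (touchingEdges N d).Finite := fun d =>
    (finite_edgesIn (finite_rect 0 N N)).subset fun e he v hv => (he v hv).1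
  have h1 : μ.real (joinEvent (rect 0 N N) {w | w.1 = 0} {w | w.1 = N}) ≤
      ∑ d ∈ D, μ.real (minCutEvent N d) := by
    refine (measureReal_mono ?_ (measure_ne_top _ _)).trans
      (measureReal_biUnion_finset_le D (minCutEvent N))
    rintro ω ⟨u, hu, v, hv, h⟩
    obtain ⟨A, hA⟩ := h.exists_isCut hN hu hv
    obtain ⟨d, hd⟩ := exists_minimal_isCut hA
    simp only [Set.mem_iUnion, exists_prop]
    exact ⟨d, Finset.mem_filter.2 ⟨Finset.mem_powerset.2 hd.prop.subset_box, hd.prop.bottom_mem⟩,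
      hd⟩
  have h2 : ∀ d ∈ D, μ.real (joinEvent R {w | w.2 = 0} T) ≤
      2 * μ.real (avoidEvent N d R T) := by
    intro d hd
    have h3 := measureReal_preimage_pullback (isLatticeAut_reflect (2 * N)) hp hμ
      (hRfin.subset Set.sdiff_subset) (determinedBy_avoidEvent N d R T)
    calc _ ≤ _ := measureReal_mono
            (joinEvent_subset_avoidEvent_union hc hN (Finset.mem_filter.1 hd).2 hT')
      _ ≤ _ := measureReal_union_le _ _
      _ = _ := (congrArg (_ + ·) h3).trans (two_mul _).symm
  have h3 : ∑ d ∈ D, μ.real (minCutEvent N d ∩ avoidEvent N d R T) ≤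
      μ.real (joinEvent (rect 0 (2 * N - c) N) {w | w.1 = 0} T) := by
    rw [← measureReal_biUnion_finset]
    · exact measureReal_mono (Set.iUnion₂_subset fun d _ =>
        minCutEvent_inter_avoidEvent_subset hN hc hcN hT)
    · intro d _ d' _ hne
      refine Set.disjoint_left.2 fun ω h h' => hne ?_
      exact minimal_isCut_unique h.1 h'.1
    · intro d _
      exact ((determinedBy_minCutEvent N d).measurableSet (htouch d)).inter
        ((determinedBy_avoidEvent N d R T).measurableSet (hRfin.subset Set.sdiff_subset))
  calc _ ≤ (∑ d ∈ D, μ.real (minCutEvent N d)) * μ.real (joinEvent R {w | w.2 = 0} T) := by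
        gcongr
    _ = ∑ d ∈ D, μ.real (minCutEvent N d) * μ.real (joinEvent R {w | w.2 = 0} T) :=
        Finset.sum_mul _ _ _
    _ ≤ ∑ d ∈ D, μ.real (minCutEvent N d) * (2 * μ.real (avoidEvent N d R T)) := by
        gcongr with d hd
        exact h2 d hd
    _ = 2 * ∑ d ∈ D, μ.real (minCutEvent N d ∩ avoidEvent N d R T) := by
        rw [Finset.mul_sum]
        refine Finset.sum_congr rfl fun d _ => ?_
        rw [measureReal_inter_of_disjoint hp hμ (htouch d) (hRfin.subset Set.sdiff_subset)
          Set.disjoint_sdiff_right (determinedBy_minCutEvent N d) (determinedBy_avoidEvent N d R T)]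
        ring
    _ ≤ _ := by gcongr

theorem measureReal_joinEvent_bottom_top (hp : p ∈ Set.Ioo (0 : ℝ) 1)
    (hμ : IsBernoulliProduct p μ) (N : ℤ) :
    μ.real (joinEvent (rect 0 N N) {w | w.2 = 0} {w | w.2 = N}) =
      μ.real (joinEvent (rect 0 N N) {w | w.1 = 0} {w | w.1 = N}) := by
  rw [← measureReal_joinEvent_preimage isLatticeAut_prodComm hp hμ (finite_rect _ _ _)]
  congr 2
  ext w
  simp only [rect, Set.mem_ofPred_eq, Set.mem_preimage, Equiv.prodComm_apply, Prod.fst_swap,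
    Prod.snd_swap]
  tauto

/-- Harris' inequality for connection events. -/
theorem measureReal_joinEvent_mul_le (hp : p ∈ Set.Ioo (0 : ℝ) 1) (hμ : IsBernoulliProduct p μ)
    {R R' A A' B B' : Set (ℤ × ℤ)} (hR : R.Finite) (hR' : R'.Finite) :
    μ.real (joinEvent R A B) * μ.real (joinEvent R' A' B') ≤
      μ.real (joinEvent R A B ∩ joinEvent R' A' B') :=
  harris_inequality hp hμ (finite_edgesIn hR) (finite_edgesIn hR') (determinedBy_joinEvent _ _ _)
    (determinedBy_joinEvent _ _ _) (isUpperSet_joinEvent _ _ _) (isUpperSet_joinEvent _ _ _)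

/-- The left side of `[0, 3 M] × [0, 2 M]` is joined to the right half of the top. -/
theorem sq_le_four_mul_left_top (hp : p ∈ Set.Ioo (0 : ℝ) 1) (hμ : IsBernoulliProduct p μ)
    {M a : ℤ} (hM : 1 ≤ M) (ha : 2 * a ≤ 3 * M + 1) (ha' : 3 * M ≤ 2 * a) :
    μ.real (joinEvent (rect 0 (2 * M) (2 * M)) {w | w.1 = 0} {w | w.1 = 2 * M}) ^ 2 ≤
      4 * μ.real (joinEvent (rect 0 (3 * M) (2 * M)) {w | w.1 = 0}
        {w | w.2 = 2 * M ∧ a ≤ w.1}) := by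
  set Q := rect 0 (2 * M) (2 * M)
  set h := μ.real (joinEvent Q {w | w.1 = 0} {w | w.1 = 2 * M}) with hh
  have h0 : 0 ≤ h := measureReal_nonneg
  set tr := μ.real (joinEvent Q {w | w.2 = 0} {w | w.2 = 2 * M ∧ a ≤ w.1}) with htr
  set tm := μ.real (joinEvent Q {w | w.2 = 0}
    {w | w.2 = 2 * M ∧ 2 * M - a < w.1 ∧ w.1 < a}) with htm
  have htl : μ.real (joinEvent Q {w | w.2 = 0} {w | w.2 = 2 * M ∧ w.1 ≤ 2 * M - a}) = tr := by
    rw [htr, ← measureReal_joinEvent_preimage (isLatticeAut_reflect (2 * M)) hp hμ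
      (finite_rect _ _ _)]
    congr 2
    · ext w
      simp [Q, rect, reflect]
      omega
    · ext w
      simp [reflect]
      omega
  have hsum : h ≤ tr + tr + tm := by
    rw [hh, ← measureReal_joinEvent_bottom_top hp hμ]
    calc _ ≤ μ.real (joinEvent Q {w | w.2 = 0} {w | w.2 = 2 * M ∧ a ≤ w.1} ∪
            joinEvent Q {w | w.2 = 0} {w | w.2 = 2 * M ∧ w.1 ≤ 2 * M - a} ∪
            joinEvent Q {w | w.2 = 0} {w | w.2 = 2 * M ∧ 2 * M - a < w.1 ∧ w.1 < a}) := by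
          refine measureReal_mono ?_
          rintro ω ⟨u, hu, v, hv, huv⟩
          rcases le_or_gt a v.1 with h1 | h1
          · exact Or.inl (Or.inl ⟨u, hu, v, ⟨hv, h1⟩, huv⟩)
          rcases le_or_gt v.1 (2 * M - a) with h2 | h2
          · exact Or.inl (Or.inr ⟨u, hu, v, ⟨hv, h2⟩, huv⟩)
          · exact Or.inr ⟨u, hu, v, ⟨hv, h2, h1⟩, huv⟩
      _ ≤ _ := (measureReal_union_le _ _).trans
          (add_le_add (measureReal_union_le _ _) le_rfl)
      _ = _ := by rw [htl]
  have hright : h * tr ≤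
      μ.real (joinEvent (rect 0 (3 * M) (2 * M)) {w | w.1 = 0} {w | w.2 = 2 * M ∧ a ≤ w.1}) := by
    refine (measureReal_joinEvent_mul_le hp hμ (finite_rect _ _ _) (finite_rect _ _ _)).trans
      (measureReal_mono ?_)
    rintro ω ⟨⟨u, hu, v, hv, huv⟩, s, hs, t, ht, hst⟩
    have h1 := (joined_of_left_right_of_bottom_top huv hst hu hv hs ht.1).trans hst
    exact ⟨u, hu, t, ht, h1.mono le_rfl (rect_subset_rect le_rfl (by omega))⟩
  have hmid : h * tm ≤ 2 *
      μ.real (joinEvent (rect 0 (3 * M) (2 * M)) {w | w.1 = 0} {w | w.2 = 2 * M ∧ a ≤ w.1}) := by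
    have h1 := measureReal_mul_le_two_mul_joinEvent hp hμ (N := 2 * M) (c := M) (by omega)
      (by omega) (by omega) (T := {w | w.2 = 2 * M ∧ 3 * M - a < w.1 ∧ w.1 < a + M})
      (fun t ht => ht.1) (by ext w; simp [reflect]; omega)
    have h2 : 2 * (2 * M) - M = 3 * M := by ring
    rw [h2, ← measureReal_joinEvent_preimage (isLatticeAut_translate M) hp hμ
      (finite_rect M (3 * M) (2 * M))] at h1
    have h3 : translate M ⁻¹' rect M (3 * M) (2 * M) = Q := by
      ext w
      simp [Q, rect, translate]
      omega
    have h4 : translate M ⁻¹' {w | w.2 = 2 * M ∧ 3 * M - a < w.1 ∧ w.1 < a + M} =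
        {w | w.2 = 2 * M ∧ 2 * M - a < w.1 ∧ w.1 < a} := by
      ext w
      simp [translate]
      omega
    rw [h3, h4] at h1
    refine h1.trans (mul_le_mul_of_nonneg_left (measureReal_mono
      (joinEvent_mono subset_rfl subset_rfl ?_)) zero_le_two)
    rintro w ⟨h5, h6, -⟩
    exact ⟨h5, by omega⟩
  nlinarith

theorem left_top_sq_le (hp : p ∈ Set.Ioo (0 : ℝ) 1) (hμ : IsBernoulliProduct p μ)
    {L N a : ℤ} (ha : L ≤ 2 * a) :
    μ.real (joinEvent (rect 0 L N) {w | w.1 = 0} {w | w.2 = N ∧ a ≤ w.1}) ^ 2 ≤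
      μ.real (joinEvent (rect 0 L N) {w | w.1 = 0} {w | w.1 = L}) := by
  have h1 : μ.real (joinEvent (rect 0 L N) {w | w.1 = L} {w | w.2 = N ∧ w.1 ≤ L - a}) =
      μ.real (joinEvent (rect 0 L N) {w | w.1 = 0} {w | w.2 = N ∧ a ≤ w.1}) := by
    rw [← measureReal_joinEvent_preimage (isLatticeAut_reflect L) hp hμ (finite_rect _ _ _)]
    congr 2
    · ext w
      simp [rect, reflect]
      omega
    · ext w
      simp [reflect]
    · ext w
      simp [reflect]
      omega
  rw [sq]
  nth_rewrite 2 [← h1]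
  refine (measureReal_joinEvent_mul_le hp hμ (finite_rect _ _ _) (finite_rect _ _ _)).trans
    (measureReal_mono ?_)
  rintro ω ⟨⟨u, hu, v, hv, huv⟩, s, hs, t, ht, hst⟩
  exact ⟨u, hu, s, hs, joined_of_left_top_of_right_top huv hst hu hv.1 hs ht.1
    (by have := hv.2; have := ht.2; omega)⟩

theorem crossing_sq_mul_le (hp : p ∈ Set.Ioo (0 : ℝ) 1) (hμ : IsBernoulliProduct p μ)
    {M : ℤ} (hM : 0 ≤ M) :
    μ.real (joinEvent (rect 0 (3 * M) (2 * M)) {w | w.1 = 0} {w | w.1 = 3 * M}) ^ 2 *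
        μ.real (joinEvent (rect 0 (2 * M) (2 * M)) {w | w.1 = 0} {w | w.1 = 2 * M}) ≤
      μ.real (joinEvent (rect 0 (4 * M) (2 * M)) {w | w.1 = 0} {w | w.1 = 4 * M}) := by
  have h1 : μ.real (joinEvent (rect M (4 * M) (2 * M)) {w | w.1 = M} {w | w.1 = 4 * M}) =
      μ.real (joinEvent (rect 0 (3 * M) (2 * M)) {w | w.1 = 0} {w | w.1 = 3 * M}) := by
    rw [← measureReal_joinEvent_preimage (isLatticeAut_translate M) hp hμ (finite_rect _ _ _)]
    congr 2
    · ext w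
      simp [rect, translate]
      omega
    · ext w
      simp [translate]
    · ext w
      simp [translate]
      omega
  have h2 : μ.real (joinEvent (rect M (3 * M) (2 * M)) {w | w.2 = 0} {w | w.2 = 2 * M}) =
      μ.real (joinEvent (rect 0 (2 * M) (2 * M)) {w | w.1 = 0} {w | w.1 = 2 * M}) := by
    rw [← measureReal_joinEvent_bottom_top hp hμ,
      ← measureReal_joinEvent_preimage (isLatticeAut_translate M) hp hμ (finite_rect _ _ _)]
    congr 2
    ext w
    simp [rect, translate]
    omega
  have hdet : DeterminedBy
      (joinEvent (rect 0 (3 * M) (2 * M)) {w | w.1 = 0} {w | w.1 = 3 * M} ∩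
        joinEvent (rect M (4 * M) (2 * M)) {w | w.1 = M} {w | w.1 = 4 * M})
      (edgesIn (rect 0 (4 * M) (2 * M))) :=
    ((determinedBy_joinEvent _ _ _).mono (edgesIn_mono (rect_subset_rect le_rfl (by omega)))).inter
      ((determinedBy_joinEvent _ _ _).mono (edgesIn_mono (rect_subset_rect hM le_rfl)))
  rw [sq, ← h2]
  nth_rewrite 2 [← h1]
  refine (mul_le_mul_of_nonneg_right (measureReal_joinEvent_mul_le hp hμ (finite_rect _ _ _)
    (finite_rect _ _ _)) measureReal_nonneg).trans ?_
  refine (harris_inequality hp hμ (finite_edgesIn (finite_rect _ _ _))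
    (finite_edgesIn (finite_rect _ _ _)) hdet (determinedBy_joinEvent _ _ _)
    ((isUpperSet_joinEvent _ _ _).inter (isUpperSet_joinEvent _ _ _))
    (isUpperSet_joinEvent _ _ _)).trans (measureReal_mono ?_)
  rintro ω ⟨⟨⟨u, hu, v, hv, huv⟩, u', hu', v', hv', huv'⟩, s, hs, t, ht, hst⟩
  have h3 := joined_of_left_right_of_bottom_top huv
    (hst.mono le_rfl (rect_subset_rect hM le_rfl)) hu hv hs ht
  have h4 := joined_of_left_right_of_bottom_top huv'
    (hst.mono le_rfl (rect_subset_rect le_rfl (by omega))) hu' hv' hs ht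
  exact ⟨u, hu, v', hv', (h3.mono le_rfl (rect_subset_rect le_rfl (by omega))).trans
    ((h4.symm.trans huv').mono le_rfl (rect_subset_rect hM le_rfl))⟩

/-- A quantitative Russo–Seymour–Welsh inequality. -/
theorem pow_nine_le_measureReal_joinEvent (hp : p ∈ Set.Ioo (0 : ℝ) 1)
    (hμ : IsBernoulliProduct p μ) {M : ℤ} (hM : 1 ≤ M) :
    μ.real (joinEvent (rect 0 (2 * M) (2 * M)) {w | w.1 = 0} {w | w.1 = 2 * M}) ^ 9 / 256 ≤
      μ.real (joinEvent (rect 0 (4 * M) (2 * M)) {w | w.1 = 0} {w | w.1 = 4 * M}) := by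
  have h1 := sq_le_four_mul_left_top hp hμ hM (a := (3 * M + 1) / 2) (by omega) (by omega)
  have h2 := left_top_sq_le hp hμ (L := 3 * M) (N := 2 * M) (a := (3 * M + 1) / 2) (by omega)
  refine le_trans ?_ (crossing_sq_mul_le hp hμ (by omega : 0 ≤ M))
  set h := μ.real (joinEvent (rect 0 (2 * M) (2 * M)) {w | w.1 = 0} {w | w.1 = 2 * M})
  have h0 : 0 ≤ h := measureReal_nonneg
  calc h ^ 9 / 256 = ((h ^ 2 / 4) ^ 2) ^ 2 * h := by ring
    _ ≤ _ := by
      gcongr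
      refine le_trans ?_ h2
      gcongr
      linarith

end Probability

/-- A path given by its steps, as a finite sequence of vertices. -/
theorem exists_seq_of_reflTransGen {ω : PercConfig} {R : Set (ℤ × ℤ)} {u v : ℤ × ℤ} (hu : u ∈ R)
    (h : ReflTransGen (OpenStep ω R) u v) :
    ∃ (k : ℕ) (x : Fin (k + 1) → ℤ × ℤ), (∀ i, x i ∈ R) ∧ x 0 = u ∧ x (Fin.last k) = v ∧
      ∀ i : Fin k, OpenAdj ω (x i.castSucc) (x i.succ) := by
  induction h using ReflTransGen.head_induction_on with
  | refl => exact ⟨0, fun _ => v, fun _ => hu, rfl, rfl, fun i => i.elim0⟩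
  | @head a b hab _ ih =>
    obtain ⟨k, x, h1, h2, h3, h4⟩ := ih hab.2.1
    refine ⟨k + 1, Fin.cons a x, fun i => ?_, rfl, ?_, fun i => ?_⟩
    · refine Fin.cases hu (fun j => ?_) i
      rw [Fin.cons_succ]
      exact h1 j
    · rw [← Fin.succ_last, Fin.cons_succ, h3]
    · refine Fin.cases ?_ (fun j => ?_) i
      · rw [Fin.castSucc_zero, Fin.cons_zero, Fin.cons_succ, h2]
        exact hab.2.2
      · rw [← Fin.succ_castSucc, Fin.cons_succ, Fin.cons_succ]
        exact h4 j

theorem setOf_crossing_eq (m n : ℕ) :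
    {ω : PercConfig | Crossing m n ω} =
      joinEvent (rect 0 m n) {w | w.1 = 0} {w | w.1 = (m : ℤ)} := by
  ext ω
  constructor
  · rintro ⟨k, x, hx, h0, hk, h⟩
    refine ⟨x 0, h0, x (Fin.last k), hk, ?_⟩
    refine Fin.induction (motive := fun i => Joined ω (rect 0 m n) (x 0) (x i))
      (Joined.refl (hx 0)) (fun i hi => hi.tail ⟨hx _, hx _, h i⟩) _
  · rintro ⟨u, hu, v, hv, huR, h⟩
    obtain ⟨k, x, h1, rfl, rfl, h4⟩ := exists_seq_of_reflTransGen huR h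
    exact ⟨k, x, h1, hu, hv, h4⟩

end Percolation

/-- **Russo–Seymour–Welsh lemma.** There is a continuous function `f : (0,1) → (0,1)` such
that for every `p ∈ (0,1)` and every `m ≥ 1` the sponge-crossing probabilities of bond
percolation on `ℤ²` satisfy `π_p(4m, 2m) ≥ f(π_p(2m, 2m))`. -/
theorem russo_seymour_welsh :
    ∃ f : ℝ → ℝ, ContinuousOn f (Set.Ioo 0 1) ∧
      Set.MapsTo f (Set.Ioo 0 1) (Set.Ioo 0 1) ∧
      ∀ p ∈ Set.Ioo (0 : ℝ) 1, ∀ μ : Measure PercConfig,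
        IsProbabilityMeasure μ → IsBernoulliProduct p μ → ∀ m : ℕ, 1 ≤ m →
          f ((μ {ω : PercConfig | Crossing (2 * m) (2 * m) ω}).toReal) ≤
            (μ {ω : PercConfig | Crossing (4 * m) (2 * m) ω}).toReal := by
  refine ⟨fun x => x ^ 9 / 256, by fun_prop, fun x hx => ⟨by have := hx.1; positivity, ?_⟩,
    fun p hp μ _ hμ m hm => ?_⟩
  · have : x ^ 9 ≤ 1 := pow_le_one₀ hx.1.le hx.2.le
    linarith
  · have h := Percolation.pow_nine_le_measureReal_joinEvent hp hμ (M := m) (by omega)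
    rw [Percolation.setOf_crossing_eq, Percolation.setOf_crossing_eq]
    push_cast
    exact h
end

section
/- (Knuth) Let g(n) denote the number of matroids on the ground set {1, …, n}. Then for all sufficiently large n, log₂(n! · g(n)) ≥ binom(n, ⌊n/2⌋) / (2n). -/
open Filter

/-- `matroidCount n = g(n)`, the number of (labelled) matroids on the ground set
`{1, …, n}`, here realised as `Fin n`. -/
noncomputable def matroidCount (n : ℕ) : ℕ :=
  Set.ncard {M : Matroid (Fin n) | M.E = Set.univ}

/-- A family of finsets is exchange-free if it never contains both `insert y A` and `insert z A`
for distinct `y, z ∉ A`. -/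
def ExchangeFree {α : Type*} [DecidableEq α] (𝒮 : Finset (Finset α)) : Prop :=
  ∀ (A : Finset α) (y z : α), y ∉ A → z ∉ A → insert y A ∈ 𝒮 → insert z A ∈ 𝒮 → y = z

theorem ExchangeFree.subset {α : Type*} [DecidableEq α] {𝒮 𝒯 : Finset (Finset α)}
    (h : ExchangeFree 𝒮) (h𝒯 : 𝒯 ⊆ 𝒮) : ExchangeFree 𝒯 :=
  fun A y z hy hz hyA hzA => h A y z hy hz (h𝒯 hyA) (h𝒯 hzA)

/-- Some set of size `k` lies outside any given exchange-free family, if `0 < k < |α|`. -/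
theorem ExchangeFree.exists_notMem {α : Type*} [DecidableEq α] [Fintype α]
    {𝒮 : Finset (Finset α)} (h : ExchangeFree 𝒮) {k : ℕ} (hk : 0 < k)
    (hkn : k < Fintype.card α) : ∃ F : Finset α, F.card = k ∧ F ∉ 𝒮 := by
  obtain ⟨B, hB⟩ := Finset.exists_subset_card_eq (s := (Finset.univ : Finset α)) (n := k + 1)
    (by rw [Finset.card_univ]; omega)
  obtain ⟨y, hy, z, hz, hyz⟩ := Finset.one_lt_card.1 (show 1 < B.card by omega)
  by_contra! hall
  have hcard : ∀ x ∈ B, B.erase x ∈ 𝒮 := fun x hx =>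
    hall _ (by rw [Finset.card_erase_of_mem hx]; omega)
  refine hyz (h ((B.erase y).erase z) y z (by simp) (by simp) ?_ ?_)
  · rw [Finset.erase_right_comm, Finset.insert_erase (by simp [hy, hyz])]
    exact hcard z hz
  · rw [Finset.insert_erase (by simp [hz, hyz.symm])]
    exact hcard y hy

/-- The sparse paving matroid of rank `k` whose circuit-hyperplanes are the `k`-sets in an
exchange-free family `𝒮`. -/
def sparsePaving {α : Type*} [DecidableEq α] [Fintype α] (k : ℕ) (hk : 0 < k)
    (hkn : k < Fintype.card α) (𝒮 : Finset (Finset α)) (h : ExchangeFree 𝒮) : Matroid α :=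
  Matroid.ofIsBaseOfFinite (E := Set.univ) Set.finite_univ
    (fun B => ∃ F : Finset α, (F : Set α) = B ∧ F.card = k ∧ F ∉ 𝒮)
    (by
      obtain ⟨F, hF⟩ := h.exists_notMem hk hkn
      exact ⟨F, F, rfl, hF⟩)
    (by
      rintro _ _ ⟨A, rfl, hA, hA𝒮⟩ ⟨B, rfl, hB, hB𝒮⟩ x ⟨hxA, hxB⟩
      simp only [Finset.mem_coe] at hxA hxB
      have key : ∀ y, y ∈ B → y ∉ A → insert y (A.erase x) ∉ 𝒮 →
          ∃ y ∈ (B : Set α) \ A, ∃ F : Finset α,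
            (F : Set α) = insert y ((A : Set α) \ {x}) ∧ F.card = k ∧ F ∉ 𝒮 := by
        intro y hyB hyA hy
        refine ⟨y, ⟨hyB, hyA⟩, insert y (A.erase x), by simp, ?_, hy⟩
        rw [Finset.card_insert_of_notMem (by simp [hyA]), Finset.card_erase_of_mem hxA]
        omega
      have hdiff : (A \ B).card = (B \ A).card := Finset.card_sdiff_comm (hA.trans hB.symm)
      have hpos : 0 < (B \ A).card :=
        hdiff ▸ Finset.card_pos.2 ⟨x, Finset.mem_sdiff.2 ⟨hxA, hxB⟩⟩
      by_contra hcon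
      have hall : ∀ y, y ∈ B → y ∉ A → insert y (A.erase x) ∈ 𝒮 := fun y hyB hyA =>
        by_contra fun hy => hcon (key y hyB hyA hy)
      have hone : (B \ A).card = 1 := by
        refine le_antisymm (Finset.card_le_one.2 fun y hy z hz => ?_) hpos
        rw [Finset.mem_sdiff] at hy hz
        exact h (A.erase x) y z (by simp [hy.2]) (by simp [hz.2])
          (hall y hy.1 hy.2) (hall z hz.1 hz.2)
      obtain ⟨y, hy⟩ := Finset.card_eq_one.1 hone
      obtain ⟨x', hx'⟩ := Finset.card_eq_one.1 (hdiff.trans hone)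
      have hmemy : ∀ w, (w ∈ B ∧ w ∉ A) ↔ w = y := fun w => by
        rw [← Finset.mem_sdiff, hy, Finset.mem_singleton]
      have hmemx : ∀ w, (w ∈ A ∧ w ∉ B) ↔ w = x' := fun w => by
        rw [← Finset.mem_sdiff, hx', Finset.mem_singleton]
      have hBeq : insert y (A.erase x) = B := by
        ext w
        have h₁ := hmemy w
        have h₂ := hmemx w
        have h₃ := (hmemx x).1 ⟨hxA, hxB⟩
        simp only [Finset.mem_insert, Finset.mem_erase]
        grind
      have hyBA := (hmemy y).2 rfl
      exact hB𝒮 (hBeq ▸ hall y hyBA.1 hyBA.2))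
    (fun _ _ => Set.subset_univ _)

theorem sparsePaving_isBase_coe {α : Type*} [DecidableEq α] [Fintype α] {k : ℕ} (hk : 0 < k)
    (hkn : k < Fintype.card α) {𝒮 : Finset (Finset α)} (h : ExchangeFree 𝒮) (F : Finset α) :
    (sparsePaving k hk hkn 𝒮 h).IsBase F ↔ F.card = k ∧ F ∉ 𝒮 := by
  change (∃ G : Finset α, (G : Set α) = F ∧ G.card = k ∧ G ∉ 𝒮) ↔ _
  simp only [Finset.coe_inj, exists_eq_left]

instance finite_matroid {α : Type*} [Finite α] : Finite (Matroid α) :=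
  Finite.of_injective (fun M : Matroid α => (M.E, {B | M.IsBase B})) fun M N hMN => by
    simp only [Prod.mk.injEq] at hMN
    exact Matroid.ext_isBase hMN.1 fun B _ => Set.ext_iff.1 hMN.2 B

/-- Each subfamily of an exchange-free family of `k`-sets gives a different sparse paving matroid. -/
theorem two_pow_card_le_ncard_matroid {α : Type*} [DecidableEq α] [Fintype α] {k : ℕ}
    (hk : 0 < k) (hkn : k < Fintype.card α) {𝒮 : Finset (Finset α)} (h : ExchangeFree 𝒮)
    (hcard : ∀ F ∈ 𝒮, F.card = k) :
    2 ^ 𝒮.card ≤ Set.ncard {M : Matroid α | M.E = Set.univ} := by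
  rw [← Finset.card_powerset, ← Set.ncard_coe_finset]
  refine Set.ncard_le_ncard_of_injOn
    (fun 𝒯 => if h𝒯 : 𝒯 ⊆ 𝒮 then sparsePaving k hk hkn 𝒯 (h.subset h𝒯) else Matroid.freeOn Set.univ)
    (fun 𝒯 h𝒯 => ?_) (fun 𝒯 h𝒯 𝒰 h𝒰 heq => ?_) (Set.toFinite _)
  · rw [Finset.mem_coe, Finset.mem_powerset] at h𝒯
    simp only [h𝒯, dite_true]
    rfl
  · rw [Finset.mem_coe, Finset.mem_powerset] at h𝒯 h𝒰
    simp only [h𝒯, h𝒰, dite_true] at heq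
    ext F
    by_cases hF : F ∈ 𝒮
    · have hbase := sparsePaving_isBase_coe hk hkn (h.subset h𝒯) F
      rw [heq, sparsePaving_isBase_coe hk hkn (h.subset h𝒰) F] at hbase
      simpa [hcard F hF, not_iff_not, iff_comm] using hbase
    · exact iff_of_false (fun hF' => hF (h𝒯 hF')) (fun hF' => hF (h𝒰 hF'))

/-- The sets with a prescribed sum of labels form an exchange-free family. -/
theorem exchangeFree_filter_sum_eq {α G : Type*} [DecidableEq α] [AddCommGroup G] [DecidableEq G]
    {f : α → G} (hf : f.Injective) (𝒯 : Finset (Finset α)) (g : G) :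
    ExchangeFree {F ∈ 𝒯 | ∑ i ∈ F, f i = g} := by
  intro A y z hy hz hyA hzA
  have hyg := (Finset.mem_filter.1 hyA).2
  have hzg := (Finset.mem_filter.1 hzA).2
  rw [Finset.sum_insert hy] at hyg
  rw [Finset.sum_insert hz, ← hyg] at hzg
  exact hf (add_right_cancel hzg).symm

/-- Graham–Sloane: there is an exchange-free family containing at least the fraction `1 / n` of all
`k`-subsets of an `n`-set. -/
theorem exists_exchangeFree_choose_div_le (n k : ℕ) [NeZero n] :
    ∃ 𝒮 : Finset (Finset (Fin n)), ExchangeFree 𝒮 ∧ (∀ F ∈ 𝒮, F.card = k) ∧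
      (n.choose k : ℝ) / n ≤ 𝒮.card := by
  have hf : Function.Injective (fun i : Fin n => ((i : ℕ) : ZMod n)) := fun i j hij => by
    have := (ZMod.natCast_eq_natCast_iff' _ _ _).1 hij
    rwa [Nat.mod_eq_of_lt i.2, Nat.mod_eq_of_lt j.2, Fin.val_inj] at this
  obtain ⟨g, -, hg⟩ := Finset.exists_le_card_fiber_of_nsmul_le_card_of_maps_to
    (s := (Finset.univ : Finset (Fin n)).powersetCard k) (t := (Finset.univ : Finset (ZMod n)))
    (f := fun F => ∑ i ∈ F, ((i : ℕ) : ZMod n)) (b := (n.choose k : ℝ) / n)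
    (fun _ _ => Finset.mem_univ _) Finset.univ_nonempty (by
      have hn : (n : ℝ) ≠ 0 := Nat.cast_ne_zero.2 (NeZero.ne n)
      simp [ZMod.card, mul_div_cancel₀ _ hn])
  exact ⟨_, exchangeFree_filter_sum_eq hf _ g,
    fun F hF => (Finset.mem_powersetCard.1 (Finset.mem_filter.1 hF).1).2, hg⟩

/-- **Knuth.** For all sufficiently large `n`,
`log₂(n! · g(n)) ≥ C(n, ⌊n/2⌋) / (2n)`. -/
theorem knuth_matroid_lower_bound :
    ∀ᶠ n : ℕ in atTop,
      (n.choose (n / 2) : ℝ) / (2 * n) ≤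
        Real.logb 2 ((n.factorial : ℝ) * (matroidCount n : ℝ)) := by
  filter_upwards [eventually_ge_atTop 2] with n hn
  have : NeZero n := ⟨by omega⟩
  obtain ⟨𝒮, h𝒮, hcard, hle⟩ := exists_exchangeFree_choose_div_le n (n / 2)
  have hcount : 2 ^ 𝒮.card ≤ matroidCount n :=
    two_pow_card_le_ncard_matroid (by omega) (by rw [Fintype.card_fin]; omega) h𝒮 hcard
  have hfac : (2 : ℝ) ^ 𝒮.card ≤ (n.factorial : ℝ) * matroidCount n := by
    exact_mod_cast hcount.trans (Nat.le_mul_of_pos_left _ n.factorial_pos)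
  calc (n.choose (n / 2) : ℝ) / (2 * n) ≤ (n.choose (n / 2) : ℝ) / n := by
        have : (0 : ℝ) < n := by positivity
        gcongr
        linarith
    _ ≤ 𝒮.card := hle
    _ = Real.logb 2 ((2 : ℝ) ^ 𝒮.card) := by simp [Real.logb_pow]
    _ ≤ _ := Real.logb_le_logb_of_le one_lt_two (by positivity) hfac
end

section
/- (Piff–Welsh) Let g(n) denote the number of matroids on the ground set {1, …, n}. Then for all sufficiently large n, log₂ g(n) ≥ 2^n · n^{−5/2} · log₂ n. -/
open Filter

/-- `H` is a family of `k`-sets no two of which differ by exchanging a single element. -/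
structure IsExchangeFree {α : Type*} [DecidableEq α] (k : ℕ) (H : Finset (Finset α)) : Prop where
  card_eq : ∀ A ∈ H, A.card = k
  eq_of_insert_mem : ∀ ⦃I e f⦄, e ∉ I → f ∉ I → insert e I ∈ H → insert f I ∈ H → e = f

namespace IsExchangeFree

variable {α : Type*} [DecidableEq α] {k : ℕ} {H C : Finset (Finset α)}

theorem mono (hC : IsExchangeFree k C) (h : H ⊆ C) : IsExchangeFree k H where
  card_eq A hA := hC.card_eq A (h hA)
  eq_of_insert_mem _ _ _ he hf heH hfH := hC.eq_of_insert_mem he hf (h heH) (h hfH)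

/-- The sparse paving matroid of rank at most `k` whose dependent `k`-sets are the members
of `H`. -/
def matroid (hH : IsExchangeFree k H) (hne : ∅ ∉ H) : Matroid α :=
  (IndepMatroid.ofFinset Set.univ (fun I : Finset α ↦ I.card ≤ k ∧ I ∉ H)
    (by simp [hne])
    (by
      rintro I J ⟨hJ, hJH⟩ hIJ
      refine ⟨(Finset.card_le_card hIJ).trans hJ, fun hI ↦ hJH ?_⟩
      rwa [← Finset.eq_of_subset_of_card_le hIJ (hJ.trans (hH.card_eq I hI).ge)])
    (by
      rintro I J ⟨hI, hIH⟩ ⟨hJ, hJH⟩ hIJ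
      obtain ⟨e, heJ, heI⟩ := Finset.exists_mem_notMem_of_card_lt_card hIJ
      have hcard {x : α} (hx : x ∉ I) : (insert x I).card ≤ k := by
        rw [Finset.card_insert_of_notMem hx]
        omega
      by_cases heH : insert e I ∈ H
      · have hJe : ¬ J ⊆ insert e I := fun hsub ↦ hJH <| by
          rwa [Finset.eq_of_subset_of_card_le hsub
            (by rw [Finset.card_insert_of_notMem heI]; omega)]
        obtain ⟨f, hfJ, hf⟩ := Finset.not_subset.1 hJe
        rw [Finset.mem_insert, not_or] at hf
        exact ⟨f, hfJ, hf.2, hcard hf.2, fun hfH ↦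
          hf.1 (hH.eq_of_insert_mem hf.2 heI hfH heH)⟩
      · exact ⟨e, heJ, heI, hcard heI, heH⟩)
    (fun _ _ ↦ Set.subset_univ _)).matroid

theorem matroid_E (hH : IsExchangeFree k H) (hne : ∅ ∉ H) : (hH.matroid hne).E = Set.univ := rfl

theorem matroid_indep_iff (hH : IsExchangeFree k H) (hne : ∅ ∉ H) (I : Finset α) :
    (hH.matroid hne).Indep I ↔ I.card ≤ k ∧ I ∉ H := by
  simp [matroid]

theorem subset_of_matroid_eq {H' : Finset (Finset α)} (hH : IsExchangeFree k H)
    (hH' : IsExchangeFree k H') (hne : ∅ ∉ H) (hne' : ∅ ∉ H')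
    (h : hH.matroid hne = hH'.matroid hne') : H ⊆ H' := by
  intro A hA
  have hiff := hH.matroid_indep_iff hne A
  rw [h, hH'.matroid_indep_iff hne' A] at hiff
  have hk := (hH.card_eq A hA).le
  tauto

theorem matroid_inj {H' : Finset (Finset α)} {hH : IsExchangeFree k H}
    {hH' : IsExchangeFree k H'} {hne : ∅ ∉ H} {hne' : ∅ ∉ H'} :
    hH.matroid hne = hH'.matroid hne' ↔ H = H' := by
  refine ⟨fun h ↦ ?_, fun h ↦ by subst h; rfl⟩
  exact (subset_of_matroid_eq hH hH' hne hne' h).antisymm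
    (subset_of_matroid_eq hH' hH hne' hne h.symm)

end IsExchangeFree

theorem finite_setOf_matroid_ground_eq {α : Type*} [Finite α] (E : Set α) :
    {M : Matroid α | M.E = E}.Finite := by
  refine Set.Finite.of_injOn (f := fun M : Matroid α ↦ {B | M.IsBase B})
    (Set.mapsTo_univ _ _) ?_ Set.finite_univ
  intro M hM N hN h
  exact Matroid.ext_isBase (hM.trans hN.symm) fun B _ ↦ Set.ext_iff.1 h B

theorem IsExchangeFree.two_pow_card_le_matroidCount {n k : ℕ} {C : Finset (Finset (Fin n))}
    (hC : IsExchangeFree k C) (hne : ∅ ∉ C) : 2 ^ C.card ≤ matroidCount n := by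
  have hsub (H : C.powerset) : (H : Finset (Finset (Fin n))) ⊆ C := Finset.mem_powerset.1 H.2
  let F (H : C.powerset) : Matroid (Fin n) :=
    (hC.mono (hsub H)).matroid fun h ↦ hne (hsub H h)
  have hF : Function.Injective F := fun H H' h ↦ Subtype.ext (IsExchangeFree.matroid_inj.1 h)
  have hcard : (Set.range F).ncard = 2 ^ C.card := by
    rw [← Set.image_univ, Set.ncard_image_of_injective _ hF, Set.ncard_univ,
      Nat.card_eq_fintype_card, Fintype.card_coe, Finset.card_powerset]
  rw [← hcard]
  refine Set.ncard_le_ncard ?_ (finite_setOf_matroid_ground_eq _)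
  rintro _ ⟨H, rfl⟩
  exact IsExchangeFree.matroid_E _ _

/-- The Graham–Sloane construction: partition the nonempty sets by cardinality and by sum
modulo `n`. -/
theorem exists_isExchangeFree (n : ℕ) (hn : n ≠ 0) :
    ∃ (k : ℕ) (C : Finset (Finset (Fin n))), IsExchangeFree k C ∧ ∅ ∉ C ∧
      2 ^ n - 1 ≤ n * n * C.card := by
  have : NeZero n := ⟨hn⟩
  let S : Finset (Finset (Fin n)) := Finset.univ.erase ∅
  let T : Finset (ℕ × ZMod n) := Finset.Icc 1 n ×ˢ Finset.univ
  let F (A : Finset (Fin n)) : ℕ × ZMod n := (A.card, ∑ i ∈ A, ((i : ℕ) : ZMod n))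
  have hF : ∀ A ∈ S, F A ∈ T := by
    intro A hA
    have hA : A ≠ ∅ := by simpa [S] using hA
    have hpos := Finset.card_pos.2 (Finset.nonempty_iff_ne_empty.2 hA)
    have hle : A.card ≤ n := by simpa using A.card_le_univ
    exact Finset.mem_product.2 ⟨Finset.mem_Icc.2 ⟨hpos, hle⟩, Finset.mem_univ _⟩
  have hS : S.card = 2 ^ n - 1 := by simp [S]
  have hT : T.card = n * n := by simp [T, ZMod.card]
  have hTne : T.Nonempty := by
    rw [← Finset.card_pos, hT]
    positivity
  obtain ⟨y, -, hy⟩ := Finset.exists_max_image T (fun y ↦ (S.filter (F · = y)).card) hTne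
  refine ⟨y.1, S.filter (F · = y), ⟨?_, ?_⟩, by simp [S], ?_⟩
  · rintro A hA
    exact congrArg Prod.fst (Finset.mem_filter.1 hA).2
  · intro I e f he hf heC hfC
    have hsum := congrArg Prod.snd
      ((Finset.mem_filter.1 heC).2.trans (Finset.mem_filter.1 hfC).2.symm)
    simp only [F, Finset.sum_insert he, Finset.sum_insert hf, add_left_inj] at hsum
    rw [ZMod.natCast_eq_natCast_iff', Nat.mod_eq_of_lt e.2, Nat.mod_eq_of_lt f.2] at hsum
    exact Fin.ext hsum
  · rw [← hS, ← hT, Finset.card_eq_sum_card_fiberwise hF, ← smul_eq_mul]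
    exact Finset.sum_le_card_nsmul _ _ _ hy

theorem two_pow_div_le_logb_matroidCount (n : ℕ) (hn : n ≠ 0) :
    (2 : ℝ) ^ n / (2 * n ^ 2) ≤ Real.logb 2 (matroidCount n) := by
  obtain ⟨k, C, hC, hne, hcard⟩ := exists_isExchangeFree n hn
  have hle : (C.card : ℝ) ≤ Real.logb 2 (matroidCount n) := by
    have hpow : (2 : ℝ) ^ C.card ≤ matroidCount n := by
      exact_mod_cast hC.two_pow_card_le_matroidCount hne
    rw [Real.le_logb_iff_rpow_le one_lt_two (lt_of_lt_of_le (by positivity) hpow)]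
    rwa [Real.rpow_natCast]
  refine le_trans ?_ hle
  have htwo : 2 ≤ 2 ^ n := Nat.le_self_pow hn 2
  have hcast : (2 : ℝ) ^ n ≤ C.card * (2 * n ^ 2) := by
    have : 2 ^ n ≤ C.card * (2 * n ^ 2) := by
      calc 2 ^ n ≤ 2 * (2 ^ n - 1) := by omega
        _ ≤ 2 * (n * n * C.card) := by gcongr
        _ = _ := by ring
    exact_mod_cast this
  rwa [div_le_iff₀ (by positivity)]

theorem eventually_logb_two_le_sqrt_div_two :
    ∀ᶠ n : ℕ in atTop, Real.logb 2 n ≤ (n : ℝ) ^ (1 / 2 : ℝ) / 2 := by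
  have hlog2 : 0 < Real.log 2 := Real.log_pos one_lt_two
  have h := (isLittleO_log_rpow_atTop (show (0 : ℝ) < 1 / 2 by norm_num)).bound
    (half_pos hlog2)
  filter_upwards [tendsto_natCast_atTop_atTop.eventually h] with n hn
  rw [Real.norm_eq_abs, Real.norm_of_nonneg (by positivity)] at hn
  rw [Real.logb, div_le_iff₀ hlog2]
  linarith [le_abs_self (Real.log n)]

/-- **Piff–Welsh.** For all sufficiently large `n`,
`log₂ g(n) ≥ 2^n · n^{-5/2} · log₂ n`. -/
theorem piff_welsh_matroid_lower_bound :
    ∀ᶠ n : ℕ in atTop,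
      (2 : ℝ) ^ n * (n : ℝ) ^ (-(5 / 2) : ℝ) * Real.logb 2 n ≤
        Real.logb 2 (matroidCount n : ℝ) := by
  filter_upwards [eventually_logb_two_le_sqrt_div_two, eventually_ne_atTop 0] with n hlog hn
  refine le_trans ?_ (two_pow_div_le_logb_matroidCount n hn)
  have hpos : (0 : ℝ) < n := by positivity
  calc (2 : ℝ) ^ n * (n : ℝ) ^ (-(5 / 2) : ℝ) * Real.logb 2 n
      ≤ 2 ^ n * (n : ℝ) ^ (-(5 / 2) : ℝ) * ((n : ℝ) ^ (1 / 2 : ℝ) / 2) := by gcongr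
    _ = 2 ^ n * ((n : ℝ) ^ (-(5 / 2) : ℝ) * (n : ℝ) ^ (1 / 2 : ℝ)) / 2 := by ring
    _ = 2 ^ n * (n : ℝ) ^ (-(2 : ℕ) : ℝ) / 2 := by
      rw [← Real.rpow_add hpos]
      norm_num
    _ = 2 ^ n / (2 * n ^ 2) := by
      rw [Real.rpow_neg hpos.le, Real.rpow_natCast]
      field_simp
end

section
/- (Adiprasito–Huh–Katz; conjectured by Welsh) Let M be a matroid on a finite ground set E, and for k ≥ 0 let i_k denote the number of independent sets of M of cardinality k. Then the sequence (i_k) is log-concave: for all k ≥ 1, i_k² ≥ i_{k−1} · i_{k+1}. -/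
/-- `indepCount M k = i_k(M)`, the number of independent sets of `M` with exactly `k`
elements. -/
noncomputable def indepCount {α : Type*} (M : Matroid α) (k : ℕ) : ℕ :=
  Set.ncard {I : Set α | M.Indep I ∧ I.ncard = k}

open Finset Matrix

/-- The quadratic form of the symmetric matrix obtained by bordering `B` with the row and
column `c` and the corner entry `a`. -/
def borderedForm {ι : Type*} [Fintype ι] (a : ℝ) (c : ι → ℝ) (B : Matrix ι ι ℝ)
    (s : ℝ) (v : ι → ℝ) : ℝ :=
  a * s ^ 2 + 2 * s * (c ⬝ᵥ v) + v ⬝ᵥ B *ᵥ v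

/-- The bordered form is nonpositive on some hyperplane (or everywhere), that is, it has at most
one positive eigenvalue. -/
def BorderedHyperbolic {ι : Type*} [Fintype ι] (a : ℝ) (c : ι → ℝ) (B : Matrix ι ι ℝ) : Prop :=
  ∃ (t : ℝ) (w : ι → ℝ), ∀ s v, t * s + w ⬝ᵥ v = 0 → borderedForm a c B s v ≤ 0

section LinearAlgebra

variable {ι : Type*} [Fintype ι] {a : ℝ} {c : ι → ℝ} {B : Matrix ι ι ℝ}

theorem borderedForm_add (hB : B.IsSymm) (s : ℝ) (v y : ι → ℝ) :
    borderedForm a c B s (v + y) =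
      borderedForm a c B s v + 2 * (y ⬝ᵥ (s • c + B *ᵥ v)) + y ⬝ᵥ B *ᵥ y := by
  have h : v ⬝ᵥ B *ᵥ y = y ⬝ᵥ B *ᵥ v := by
    rw [dotProduct_mulVec, ← mulVec_transpose, hB.eq, dotProduct_comm]
  simp only [borderedForm, mulVec_add, dotProduct_add, add_dotProduct, dotProduct_smul, h,
    smul_eq_mul, dotProduct_comm c y]
  ring

/-- Reversed Cauchy–Schwarz inequality for a hyperbolic form against the vector `(0, 1)`. -/
theorem BorderedHyperbolic.mul_le_sq (h : BorderedHyperbolic a c B) (hB : B.IsSymm)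
    (hpos : 0 < ∑ i, ∑ j, B i j) (s : ℝ) (v : ι → ℝ) :
    borderedForm a c B s v * ∑ i, ∑ j, B i j ≤ (∑ i, (s * c i + (B *ᵥ v) i)) ^ 2 := by
  obtain ⟨t, w, h⟩ := h
  have hone : (1 : ι → ℝ) ⬝ᵥ B *ᵥ 1 = ∑ i, ∑ j, B i j := by simp [dotProduct, mulVec]
  have hw : w ⬝ᵥ 1 ≠ 0 := fun h0 => by
    have := h 0 1 (by simp [h0])
    simp only [borderedForm, hone] at this
    linarith
  set r := (t * s + w ⬝ᵥ v) / (w ⬝ᵥ 1) with hr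
  have key := h s (v + (-r) • 1) (by
    rw [dotProduct_add, dotProduct_smul, smul_eq_mul, hr]
    field_simp
    ring)
  rw [borderedForm_add hB] at key
  have h1 : ((-r) • (1 : ι → ℝ)) ⬝ᵥ (s • c + B *ᵥ v) =
      -r * ∑ i, (s * c i + (B *ᵥ v) i) := by
    rw [smul_dotProduct]; simp [dotProduct]
  have h2 : ((-r) • (1 : ι → ℝ)) ⬝ᵥ B *ᵥ ((-r) • 1) = r ^ 2 * ∑ i, ∑ j, B i j := by
    rw [mulVec_smul, smul_dotProduct, dotProduct_smul, hone]; simp only [smul_eq_mul]; ring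
  rw [h1, h2] at key
  nlinarith [sq_nonneg (∑ i, (s * c i + (B *ᵥ v) i) - r * ∑ i, ∑ j, B i j),
    mul_le_mul_of_nonneg_right key hpos.le]

/-- If every eigenvector of `S` not orthogonal to `u` has its eigenvalue in `[-1, 0]`, then the
form `S ^ 2 + 3 S` is nonpositive at `u`. -/
theorem Matrix.IsSymm.sq_add_three_mul_nonpos {S : Matrix ι ι ℝ} (hS : S.IsSymm) (u : ι → ℝ)
    (h : ∀ (r : ℝ) (x : ι → ℝ), x ⬝ᵥ x = 1 → S *ᵥ x = r • x →
      x ⬝ᵥ u = 0 ∨ (-1 ≤ r ∧ r ≤ 0)) :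
    (S *ᵥ u) ⬝ᵥ (S *ᵥ u) + 3 * (u ⬝ᵥ S *ᵥ u) ≤ 0 := by
  classical
  have hH : S.IsHermitian := by
    rw [Matrix.IsHermitian, conjTranspose_eq_transpose_of_trivial, hS.eq]
  set b := hH.eigenvectorBasis
  have hinner (x y : ι → ℝ) : x ⬝ᵥ y = ∑ k, ((b k).ofLp ⬝ᵥ x) * ((b k).ofLp ⬝ᵥ y) := by
    have := b.sum_inner_mul_inner (WithLp.toLp 2 x) (WithLp.toLp 2 y)
    simp only [EuclideanSpace.inner_eq_star_dotProduct, star_trivial] at this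
    rw [dotProduct_comm, ← this]
    exact Finset.sum_congr rfl fun k _ => by rw [dotProduct_comm y]
  have hb (k : ι) : (b k).ofLp ⬝ᵥ (S *ᵥ u) = hH.eigenvalues k * ((b k).ofLp ⬝ᵥ u) := by
    rw [dotProduct_mulVec, ← mulVec_transpose, hS.eq, hH.mulVec_eigenvectorBasis,
      smul_dotProduct, smul_eq_mul]
  rw [hinner (S *ᵥ u), hinner u, Finset.mul_sum, ← Finset.sum_add_distrib]
  refine Finset.sum_nonpos fun k _ => ?_
  rw [hb]
  have hunit : (b k).ofLp ⬝ᵥ (b k).ofLp = 1 := by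
    have := b.orthonormal.1 k
    rw [← sq_eq_sq₀ (norm_nonneg _) zero_le_one, ← real_inner_self_eq_norm_sq] at this
    simpa only [EuclideanSpace.inner_eq_star_dotProduct, star_trivial, one_pow] using this
  rcases h _ _ hunit (hH.mulVec_eigenvectorBasis k) with h0 | ⟨h1, h2⟩
  · simp [h0]
  · nlinarith [mul_nonneg (mul_nonneg (by linarith : 0 ≤ hH.eigenvalues k + 3)
      (neg_nonneg.2 h2)) (sq_nonneg ((b k).ofLp ⬝ᵥ u))]

/-- The Laplacian and the signless Laplacian of a symmetric weight matrix as sums of squares. -/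
theorem sum_mul_add_mul_sq (hB : B.IsSymm) (e : ℝ) (he : e ^ 2 = 1) (x : ι → ℝ) :
    ∑ i, ∑ j, B i j * (x i + e * x j) ^ 2 =
      2 * ∑ i, (∑ j, B i j) * x i ^ 2 + 2 * e * (x ⬝ᵥ B *ᵥ x) := by
  have h1 : ∑ i, ∑ j, B i j * x j ^ 2 = ∑ i, (∑ j, B i j) * x i ^ 2 := by
    rw [Finset.sum_comm]
    simp_rw [Finset.sum_mul]
    exact Finset.sum_congr rfl fun i _ => Finset.sum_congr rfl fun j _ => by rw [hB.apply]
  have h2 : ∑ i, ∑ j, B i j * x i ^ 2 = ∑ i, (∑ j, B i j) * x i ^ 2 := by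
    simp_rw [Finset.sum_mul]
  have h3 : x ⬝ᵥ B *ᵥ x = ∑ i, ∑ j, B i j * (x i * x j) := by
    simp only [dotProduct, mulVec, Finset.mul_sum]
    exact Finset.sum_congr rfl fun i _ => Finset.sum_congr rfl fun j _ => by ring
  calc _ = ∑ i, ∑ j, (B i j * x i ^ 2 + B i j * x j ^ 2 + 2 * e * (B i j * (x i * x j))) := by
        refine Finset.sum_congr rfl fun i _ => Finset.sum_congr rfl fun j _ => ?_
        linear_combination B i j * x j ^ 2 * he
    _ = _ := by
        simp only [Finset.sum_add_distrib, ← Finset.mul_sum, h1, h2, h3]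
        ring

/-- A Perron–Frobenius argument: let `B` be a symmetric nonnegative matrix with row sums `D` and
connected support satisfying `B ≤ B D⁻¹ B`. Then `D⁻¹ B` has spectrum in `[-1, 0]` on the
orthogonal complement of the Perron eigenvector, here in integrated form. -/
theorem sum_sq_div_add_three_mul_nonpos (hB : B.IsSymm) (hnn : ∀ i j, 0 ≤ B i j)
    (hconn : ∀ i j, 0 < ∑ k, B i k → 0 < ∑ k, B j k →
      i = j ∨ 0 < B i j ∨ ∃ k, 0 < B i k ∧ 0 < B k j)
    (H : ∀ x, x ⬝ᵥ B *ᵥ x ≤ ∑ i, (B *ᵥ x) i ^ 2 / ∑ j, B i j)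
    (g : ι → ℝ) (hg : ∀ i, ∑ j, B i j = 0 → g i = 0) (hg0 : ∑ i, g i = 0)
    (y : ι → ℝ) (hy : ∀ i, y i = g i / ∑ j, B i j) :
    (∑ i, (B *ᵥ y) i ^ 2 / ∑ j, B i j) + 3 * (y ⬝ᵥ B *ᵥ y) ≤ 0 := by
  set D : ι → ℝ := fun i => ∑ j, B i j with hD
  have hDnn (i) : 0 ≤ D i := Finset.sum_nonneg fun j _ => hnn i j
  have hB0 (i) (hi : D i = 0) (j) : B i j = 0 :=
    (Finset.sum_eq_zero_iff_of_nonneg fun j _ => hnn i j).1 hi j (Finset.mem_univ j)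
  set r : ι → ℝ := fun i => √(D i) with hr
  have hr2 (i) : r i * r i = D i := Real.mul_self_sqrt (hDnn i)
  have hrD (i) (hi : r i = 0) : D i = 0 := by rw [← hr2, hi, zero_mul]
  set S : Matrix ι ι ℝ := Matrix.of fun i j => B i j / (r i * r j) with hSdef
  have hS : S.IsSymm := by
    ext i j
    simp only [transpose_apply, hSdef, of_apply, hB.apply i j, mul_comm]
  have hSu (u : ι → ℝ) (i) : (B *ᵥ fun j => u j / r j) i = r i * (S *ᵥ u) i := by
    simp only [mulVec, dotProduct, Finset.mul_sum]
    refine Finset.sum_congr rfl fun j _ => ?_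
    simp only [hSdef, of_apply]
    by_cases hi : r i = 0
    · simp [hi, hB0 i (hrD i hi)]
    · field_simp
  have hS0 (u : ι → ℝ) (i) (hi : r i = 0) : (S *ᵥ u) i = 0 := by
    simp [mulVec, dotProduct, hSdef, hi]
  have hform (u : ι → ℝ) : (fun j => u j / r j) ⬝ᵥ B *ᵥ (fun j => u j / r j) = u ⬝ᵥ S *ᵥ u := by
    refine Finset.sum_congr rfl fun i _ => ?_
    rw [hSu]
    by_cases hi : r i = 0
    · simp [hi, hS0 u i hi]
    · field_simp
  have hsq (u : ι → ℝ) :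
      ∑ i, (B *ᵥ fun j => u j / r j) i ^ 2 / D i = (S *ᵥ u) ⬝ᵥ (S *ᵥ u) := by
    refine Finset.sum_congr rfl fun i _ => ?_
    rw [hSu, ← hr2]
    by_cases hi : r i = 0
    · simp [hi, hS0 u i hi]
    · field_simp
  set u : ι → ℝ := fun i => g i / r i with hu
  have hyu : y = fun j => u j / r j := by
    ext i; rw [hy, hu]; simp only [div_div, hr2]; rfl
  rw [hyu, hsq, hform]
  refine hS.sq_add_three_mul_nonpos u fun l x hx hSx => ?_
  set z : ι → ℝ := fun j => x j / r j with hz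
  have hle : l ≤ l ^ 2 := by
    have := H z
    rw [hz, hform, hsq, hSx, smul_dotProduct, dotProduct_smul, hx] at this
    simpa [sq] using this
  have hDz : ∑ i, D i * z i ^ 2 ≤ 1 := by
    rw [← hx]
    refine Finset.sum_le_sum fun i _ => ?_
    simp only [hz, ← hr2]
    by_cases hi : r i = 0
    · simp [hi, mul_self_nonneg]
    · apply le_of_eq; field_simp
  have hzB : z ⬝ᵥ B *ᵥ z = l := by
    rw [hz, hform, hSx, dotProduct_smul, hx]; simp
  have hterm (e : ℝ) (i j) : 0 ≤ B i j * (z i + e * z j) ^ 2 := mul_nonneg (hnn i j) (sq_nonneg _)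
  have hsum (e : ℝ) : 0 ≤ ∑ i, ∑ j, B i j * (z i + e * z j) ^ 2 :=
    Finset.sum_nonneg fun i _ => Finset.sum_nonneg fun j _ => hterm e i j
  have hplus := sum_mul_add_mul_sq hB 1 (by norm_num) z
  have hminus := sum_mul_add_mul_sq hB (-1) (by norm_num) z
  rw [hzB] at hplus hminus
  have hp := hsum 1
  have hm := hsum (-1)
  change _ = 2 * ∑ i, D i * z i ^ 2 + _ at hplus
  change _ = 2 * ∑ i, D i * z i ^ 2 + _ at hminus
  by_cases hl : l ≤ 0
  · right; constructor <;> linarith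
  left
  have hl1 : 1 ≤ l := by nlinarith
  have hzero : ∑ i, ∑ j, B i j * (z i + -1 * z j) ^ 2 = 0 := by linarith
  have hedge (i j) (hij : 0 < B i j) : z i = z j := by
    have h1 := (Finset.sum_eq_zero_iff_of_nonneg fun i _ =>
      Finset.sum_nonneg fun j _ => hterm (-1) i j).1 hzero i (Finset.mem_univ i)
    have h2 := (Finset.sum_eq_zero_iff_of_nonneg fun j _ => hterm (-1) i j).1 h1 j
      (Finset.mem_univ j)
    have h3 := pow_eq_zero_iff two_ne_zero |>.1 ((mul_eq_zero.1 h2).resolve_left hij.ne')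
    linarith
  have hxu : x ⬝ᵥ u = ∑ i, z i * g i := by
    refine Finset.sum_congr rfl fun i _ => ?_
    simp only [hz, hu]; ring
  rw [hxu]
  by_cases hex : ∃ i, 0 < D i
  · obtain ⟨i, hi⟩ := hex
    have : ∀ j, z j * g j = z i * g j := fun j => by
      rcases (hDnn j).eq_or_lt with hj | hj
      · simp [hg j hj.symm]
      · rcases hconn i j hi hj with rfl | h | ⟨k, h, h'⟩
        · rfl
        · rw [hedge i j h]
        · rw [hedge i k h, hedge k j h']
    simp_rw [this, ← Finset.mul_sum, hg0, mul_zero]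
  · push Not at hex
    exact Finset.sum_eq_zero fun i _ => by rw [hg i (le_antisymm (hex i) (hDnn i)), mul_zero]

/-- The local-to-global principle for bordered forms. -/
theorem borderedHyperbolic_of_le_sum_sq_div (hB : B.IsSymm) (hnn : ∀ i j, 0 ≤ B i j)
    (hc : ∀ i, ∑ j, B i j = 0 → c i = 0)
    (hconn : ∀ i j, 0 < ∑ k, B i k → 0 < ∑ k, B j k →
      i = j ∨ 0 < B i j ∨ ∃ k, 0 < B i k ∧ 0 < B k j)
    (H : ∀ s v, borderedForm a c B s v ≤ ∑ i, (s * c i + (B *ᵥ v) i) ^ 2 / ∑ j, B i j) :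
    BorderedHyperbolic a c B := by
  refine ⟨∑ i, c i, fun i => ∑ j, B i j, fun s v hsv => ?_⟩
  have hB0 (i) (hi : ∑ j, B i j = 0) (j) : B i j = 0 :=
    (Finset.sum_eq_zero_iff_of_nonneg fun j _ => hnn i j).1 hi j (Finset.mem_univ j)
  set g : ι → ℝ := s • c + B *ᵥ v with hgdef
  have hg (i) (hi : ∑ j, B i j = 0) : g i = 0 := by
    simp [hgdef, hc i hi, mulVec, dotProduct, hB0 i hi]
  have hg0 : ∑ i, g i = 0 := by
    have h1 : ∑ i, (B *ᵥ v) i = (fun i => ∑ j, B i j) ⬝ᵥ v := by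
      simp only [mulVec, dotProduct, Finset.sum_mul]
      rw [Finset.sum_comm]
      exact Finset.sum_congr rfl fun i _ => Finset.sum_congr rfl fun j _ => by rw [hB.apply]
    simp only [hgdef, Pi.add_apply, Pi.smul_apply, smul_eq_mul, Finset.sum_add_distrib, h1,
      ← Finset.mul_sum]
    linarith
  set y : ι → ℝ := fun i => g i / ∑ j, B i j with hy
  have key := sum_sq_div_add_three_mul_nonpos hB hnn hconn
    (fun x => by simpa [borderedForm] using H 0 x) g hg hg0 y fun _ => rfl
  have hv := H s (v + (1 / 2 : ℝ) • y)
  rw [borderedForm_add hB, ← hgdef] at hv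
  have hexp : ∑ i, (s * c i + (B *ᵥ (v + (1 / 2 : ℝ) • y)) i) ^ 2 / ∑ j, B i j =
      y ⬝ᵥ g + y ⬝ᵥ B *ᵥ y + 1 / 4 * ∑ i, (B *ᵥ y) i ^ 2 / ∑ j, B i j := by
    simp only [dotProduct, Finset.mul_sum, ← Finset.sum_add_distrib]
    refine Finset.sum_congr rfl fun i _ => ?_
    have : s * c i + (B *ᵥ (v + (1 / 2 : ℝ) • y)) i = g i + 1 / 2 * (B *ᵥ y) i := by
      simp only [hgdef, mulVec_add, mulVec_smul, Pi.add_apply, Pi.smul_apply, smul_eq_mul]; ring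
    rw [this, hy]
    ring
  rw [hexp] at hv
  simp only [mulVec_smul, smul_dotProduct, dotProduct_smul, smul_eq_mul] at hv
  linarith

/-- The quadratic form of a difference of a rank-one matrix and a block matrix. -/
theorem borderedHyperbolic_of_blocks {β : Type*} [DecidableEq β] (f : ι → β)
    (hB : ∀ i j, B i j = c i * c j - if f i = f j then c i * c j else 0) :
    BorderedHyperbolic 1 c B := by
  classical
  refine ⟨1, c, fun s v hsv => ?_⟩
  have h1 : v ⬝ᵥ B *ᵥ v = (c ⬝ᵥ v) ^ 2 -
      ∑ i, ∑ j, if f i = f j then (c i * v i) * (c j * v j) else 0 := by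
    have h0 : (c ⬝ᵥ v) ^ 2 = ∑ i, ∑ j, (c i * v i) * (c j * v j) := by
      rw [sq, dotProduct, Finset.sum_mul_sum]
    rw [h0]
    simp only [dotProduct, mulVec, ← Finset.sum_sub_distrib, Finset.mul_sum, hB]
    refine Finset.sum_congr rfl fun i _ => Finset.sum_congr rfl fun j _ => ?_
    split_ifs <;> ring
  have h2 : 0 ≤ ∑ i, ∑ j, if f i = f j then (c i * v i) * (c j * v j) else 0 := by
    have h3 : ∀ i, (∑ j, if f i = f j then (c i * v i) * (c j * v j) else 0) =
        ∑ b ∈ univ.image f, if f i = b then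
          c i * v i * (∑ j, if f j = b then c j * v j else 0) else 0 := fun i => by
      rw [Finset.sum_ite_eq, if_pos (Finset.mem_image_of_mem f (Finset.mem_univ i)),
        Finset.mul_sum]
      exact Finset.sum_congr rfl fun j _ => by simp only [mul_ite, mul_zero, eq_comm]
    simp_rw [h3]
    rw [Finset.sum_comm]
    refine Finset.sum_nonneg fun b _ => ?_
    have : (∑ i, if f i = b then c i * v i * (∑ j, if f j = b then c j * v j else 0) else 0) =
        (∑ j, if f j = b then c j * v j else 0) ^ 2 := by
      rw [sq, Finset.sum_mul]
      exact Finset.sum_congr rfl fun j _ => by simp only [ite_mul, zero_mul]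
    rw [this]
    positivity
  rw [borderedForm, h1]
  have : s = -(c ⬝ᵥ v) := by linarith
  rw [this]
  linarith

end LinearAlgebra

section Matroid

theorem Matroid.Indep.exists_superset_card_eq {α : Type*} [DecidableEq α] {M : Matroid α}
    {T J : Finset α} (hT : M.Indep (T : Set α))
    (hJ : M.Indep (J : Set α)) (h : #T ≤ #J) :
    ∃ I : Finset α, M.Indep (I : Set α) ∧ #I = #J ∧ T ⊆ I := by
  induction hd : #J - #T generalizing T with
  | zero => exact ⟨T, hT, by omega, subset_rfl⟩
  | succ d ih =>
    obtain ⟨e, -, he, hi⟩ := hT.augment_finset hJ (by omega)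
    have hcard : #(insert e T) = #T + 1 := Finset.card_insert_of_notMem he
    obtain ⟨I, hI, hIc, hTI⟩ := ih (T := insert e T) (by simpa using hi) (by omega) (by omega)
    exact ⟨I, hI, hIc, (Finset.subset_insert e T).trans hTI⟩

variable {α : Type*} [Fintype α] [DecidableEq α] (M : Matroid α)

open Classical in
/-- The number of `n`-element independent sets of `M` containing `T`. -/
noncomputable def indepAbove (n : ℕ) (T : Finset α) : ℝ :=
  #{I : Finset α | M.Indep (I : Set α) ∧ #I = n ∧ T ⊆ I}

variable {M}

theorem indepAbove_nonneg (n : ℕ) (T : Finset α) : 0 ≤ indepAbove M n T := Nat.cast_nonneg _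

theorem indepAbove_eq_zero {n : ℕ} {T : Finset α}
    (h : ∀ I : Finset α, M.Indep (I : Set α) → #I = n → ¬ T ⊆ I) : indepAbove M n T = 0 := by
  classical
  rw [indepAbove, Nat.cast_eq_zero, Finset.card_eq_zero, Finset.filter_eq_empty_iff]
  exact fun I _ hI => h I hI.1 hI.2.1 hI.2.2

theorem indepAbove_pos_iff {n : ℕ} {T : Finset α} :
    0 < indepAbove M n T ↔ ∃ I : Finset α, M.Indep (I : Set α) ∧ #I = n ∧ T ⊆ I := by
  simp [indepAbove, Finset.card_pos, Finset.Nonempty]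

theorem indepAbove_eq_zero_of_not_indep {n : ℕ} {T : Finset α} (h : ¬ M.Indep (T : Set α)) :
    indepAbove M n T = 0 :=
  indepAbove_eq_zero fun _ hI _ hT => h (hI.subset (Finset.coe_subset.2 hT))

theorem indepAbove_card {T : Finset α} (h : M.Indep (T : Set α)) :
    indepAbove M #T T = 1 := by
  rw [indepAbove, Nat.cast_eq_one, Finset.card_eq_one]
  refine ⟨T, ?_⟩
  ext I
  simp only [Finset.mem_filter, Finset.mem_univ, true_and, Finset.mem_singleton]
  constructor
  · exact fun hI => (Finset.eq_of_subset_of_card_le hI.2.2 hI.2.1.le).symm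
  · rintro rfl; exact ⟨h, rfl, subset_rfl⟩

/-- Double counting: each `n`-element independent set above `T` has `n - #T` further elements. -/
theorem sum_indepAbove_insert (n : ℕ) (T : Finset α) :
    ∑ l, (if l ∈ T then 0 else indepAbove M n (insert l T)) =
      ((n : ℝ) - #T) * indepAbove M n T := by
  classical
  have h (l : α) : (if l ∈ T then 0 else indepAbove M n (insert l T)) =
      ∑ I ∈ univ.filter (fun I : Finset α => M.Indep (I : Set α) ∧ #I = n ∧ T ⊆ I),
        if l ∈ I \ T then (1 : ℝ) else 0 := by
    rw [Finset.sum_boole, Finset.filter_filter]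
    split_ifs with hl
    · simp [hl]
    · rw [indepAbove]
      congr 2
      ext I
      simp only [Finset.mem_filter, Finset.mem_univ, true_and, Finset.insert_subset_iff,
        Finset.mem_sdiff]
      tauto
  simp_rw [h]
  rw [Finset.sum_comm, indepAbove, mul_comm, ← nsmul_eq_mul, ← Finset.sum_const]
  refine Finset.sum_congr rfl fun I hI => ?_
  obtain ⟨-, -, hn, hT⟩ := Finset.mem_filter.1 hI
  rw [Finset.sum_boole, Finset.filter_univ_mem, Finset.card_sdiff_of_subset hT,
    Nat.cast_sub (Finset.card_le_card hT), hn]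

variable (M)

/-- Border of the matrix recording the independent sets above `S`. -/
noncomputable def linkBorder (p : ℕ) (S : Finset α) (i : α) : ℝ :=
  if i ∈ S then 0 else indepAbove M (p + 1) (insert i S)

/-- The matrix counting the independent sets of size `p + 2` above `S` and a pair of elements. -/
noncomputable def linkMatrix (p : ℕ) (S : Finset α) : Matrix α α ℝ :=
  Matrix.of fun i j => if i ∈ insert j S then 0 else
    if j ∈ S then 0 else indepAbove M (p + 2) (insert i (insert j S))

variable {M} {p : ℕ} {S : Finset α}

theorem linkMatrix_apply (i j : α) : linkMatrix M p S i j =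
    if i ∈ insert j S then 0 else
      if j ∈ S then 0 else indepAbove M (p + 2) (insert i (insert j S)) := rfl

theorem linkMatrix_isSymm : (linkMatrix M p S).IsSymm := by
  ext i j
  rw [transpose_apply, linkMatrix_apply, linkMatrix_apply, Finset.insert_comm i j]
  simp only [Finset.mem_insert, eq_comm (a := i) (b := j)]
  split_ifs <;> tauto

theorem linkMatrix_nonneg (i j : α) : 0 ≤ linkMatrix M p S i j := by
  rw [linkMatrix_apply]
  split_ifs
  exacts [le_rfl, le_rfl, indepAbove_nonneg _ _]

theorem sum_linkBorder : ∑ i, linkBorder M p S i = ((p : ℝ) + 1 - #S) * indepAbove M (p + 1) S := by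
  simpa [linkBorder] using sum_indepAbove_insert (M := M) (p + 1) S

theorem sum_linkMatrix (i : α) : ∑ j, linkMatrix M p S i j =
    if i ∈ S then 0 else ((p : ℝ) + 1 - #S) * indepAbove M (p + 2) (insert i S) := by
  simp_rw [← linkMatrix_isSymm.apply i, linkMatrix_apply]
  split_ifs with hi
  · simp
  · rw [sum_indepAbove_insert, Finset.card_insert_of_notMem hi]
    push_cast; ring

theorem sum_sum_linkMatrix : ∑ i, ∑ j, linkMatrix M p S i j =
    ((p : ℝ) + 1 - #S) * (((p : ℝ) + 2 - #S) * indepAbove M (p + 2) S) := by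
  have := sum_indepAbove_insert (M := M) (p + 2) S
  push_cast at this
  rw [← this, Finset.mul_sum]
  exact Finset.sum_congr rfl fun i _ => by rw [sum_linkMatrix]; split_ifs <;> simp

theorem sum_linkMatrix_insert {l : α} (hl : l ∉ S) (i : α) :
    ∑ j, linkMatrix M p (insert l S) i j = ((p : ℝ) - #S) * linkMatrix M p S i l := by
  rw [sum_linkMatrix, linkMatrix_apply, Finset.card_insert_of_notMem hl, if_neg hl]
  push_cast
  split_ifs <;> ring

theorem sum_linkBorder_insert {l : α} (hl : l ∉ S) :
    ∑ j, linkBorder M p (insert l S) j = ((p : ℝ) - #S) * linkBorder M p S l := by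
  rw [sum_linkBorder, linkBorder, Finset.card_insert_of_notMem hl, if_neg hl]
  push_cast
  ring

theorem sum_linkMatrix_link (i j : α) :
    ∑ l, (if l ∈ S then 0 else linkMatrix M p (insert l S) i j) =
      ((p : ℝ) - #S) * linkMatrix M p S i j := by
  rw [linkMatrix_apply]
  by_cases hi : i ∈ insert j S
  · rw [if_pos hi, mul_zero]
    refine Finset.sum_eq_zero fun l _ => ?_
    have hi' : i ∈ insert j (insert l S) :=
      Finset.insert_subset_insert j (Finset.subset_insert l S) hi
    rw [linkMatrix_apply, if_pos hi', ite_self]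
  by_cases hj : j ∈ S
  · rw [if_neg hi, if_pos hj, mul_zero]
    refine Finset.sum_eq_zero fun l _ => ?_
    rw [linkMatrix_apply, if_pos (Finset.mem_insert_of_mem hj), ite_self, ite_self]
  rw [if_neg hi, if_neg hj]
  have h := sum_indepAbove_insert (M := M) (p + 2) (insert i (insert j S))
  rw [Finset.card_insert_of_notMem hi, Finset.card_insert_of_notMem hj] at h
  push_cast at h
  rw [show (p : ℝ) - #S = p + 2 - (#S + 1 + 1) by ring, ← h]
  refine Finset.sum_congr rfl fun l _ => ?_
  simp only [linkMatrix_apply, Finset.mem_insert] at hi ⊢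
  have hswap : insert i (insert j (insert l S)) = insert l (insert i (insert j S)) := by
    rw [Finset.insert_comm j l, Finset.insert_comm i l]
  rw [hswap]
  split_ifs <;> first | rfl | (exfalso; grind)

theorem sum_linkBorder_link (i : α) :
    ∑ l, (if l ∈ S then 0 else linkBorder M p (insert l S) i) =
      ((p : ℝ) - #S) * linkBorder M p S i := by
  rw [linkBorder]
  by_cases hi : i ∈ S
  · rw [if_pos hi, mul_zero]
    refine Finset.sum_eq_zero fun l _ => ?_
    rw [linkBorder, if_pos (Finset.mem_insert_of_mem hi), ite_self]
  have h := sum_indepAbove_insert (M := M) (p + 1) (insert i S)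
  rw [Finset.card_insert_of_notMem hi] at h
  push_cast at h
  rw [if_neg hi, show (p : ℝ) - #S = p + 1 - (#S + 1) by ring, ← h]
  refine Finset.sum_congr rfl fun l _ => ?_
  rw [linkBorder, Finset.insert_comm i l]
  simp only [Finset.mem_insert]
  split_ifs <;> first | rfl | (exfalso; grind)

/-- Euler's identity: the form attached to `S` is, up to a factor, the sum of the forms attached
to the sets `insert l S`. -/
theorem sum_borderedForm_link (s : ℝ) (v : α → ℝ) :
    ∑ l, (if l ∈ S then 0 else borderedForm (indepAbove M p (insert l S))
        (linkBorder M p (insert l S)) (linkMatrix M p (insert l S)) s v) =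
      ((p : ℝ) - #S) * borderedForm (indepAbove M p S) (linkBorder M p S)
        (linkMatrix M p S) s v := by
  have hexp (a : ℝ) (c : α → ℝ) (B : Matrix α α ℝ) : borderedForm a c B s v =
      a * s ^ 2 + ∑ i, c i * (2 * s * v i) + ∑ i, ∑ j, B i j * (v i * v j) := by
    simp only [borderedForm, dotProduct, mulVec, Finset.mul_sum]
    congr 2
    · exact Finset.sum_congr rfl fun i _ => by ring
    · ext i; exact Finset.sum_congr rfl fun j _ => by ring
  rw [hexp, mul_add, mul_add, ← mul_assoc, ← sum_indepAbove_insert, Finset.mul_sum,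
    Finset.mul_sum]
  simp_rw [Finset.mul_sum, ← mul_assoc _ (linkBorder _ _ _ _), ← mul_assoc _ (linkMatrix _ _ _ _ _),
    ← sum_linkBorder_link, ← sum_linkMatrix_link, Finset.sum_mul]
  rw [Finset.sum_comm (s := univ) (t := univ) (f := fun i l => _ * (2 * s * v i))]
  have : ∀ i, (∑ j, ∑ l, (if l ∈ S then 0 else linkMatrix M p (insert l S) i j) * (v i * v j)) =
      ∑ l, ∑ j, (if l ∈ S then 0 else linkMatrix M p (insert l S) i j) * (v i * v j) :=
    fun i => Finset.sum_comm
  simp_rw [this]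
  rw [Finset.sum_comm (s := univ) (t := univ) (f := fun i l => ∑ j, _ * (v i * v j)),
    ← Finset.sum_add_distrib, ← Finset.sum_add_distrib]
  refine Finset.sum_congr rfl fun l _ => ?_
  rw [hexp]
  split_ifs <;> simp

theorem borderedHyperbolic_link_base (hS : M.Indep (S : Set α)) :
    BorderedHyperbolic (indepAbove M #S S) (linkBorder M #S S) (linkMatrix M #S S) := by
  classical
  rw [indepAbove_card hS]
  have hborder (i : α) : linkBorder M #S S i =
      if i ∉ S ∧ M.Indep (insert i S : Finset α) then 1 else 0 := by
    rw [linkBorder]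
    by_cases hi : i ∈ S
    · simp [hi]
    · rw [if_neg hi, ← Finset.card_insert_of_notMem hi]
      split_ifs with h
      · exact indepAbove_card h.2
      · exact indepAbove_eq_zero_of_not_indep fun h' => h ⟨hi, h'⟩
  have hmatrix (i j : α) : linkMatrix M #S S i j =
      if i ∉ insert j S ∧ j ∉ S ∧ M.Indep (insert i (insert j S) : Finset α) then 1 else 0 := by
    rw [linkMatrix_apply]
    by_cases hi : i ∈ insert j S
    · simp [hi]
    by_cases hj : j ∈ S
    · simp [hj]
    have : #S + 2 = #(insert i (insert j S)) := by
      rw [Finset.card_insert_of_notMem hi, Finset.card_insert_of_notMem hj]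
    rw [if_neg hi, if_neg hj, this]
    split_ifs with h
    · exact indepAbove_card h.2.2
    · exact indepAbove_eq_zero_of_not_indep fun h' => h ⟨hi, hj, h'⟩
  refine borderedHyperbolic_of_blocks (fun i => M.closure (insert i S : Finset α)) fun i j => ?_
  rw [hborder, hborder, hmatrix]
  by_cases hi : i ∉ S ∧ M.Indep (insert i S : Finset α)
  swap
  · rw [if_neg hi, if_neg]
    · simp
    · rintro ⟨h1, h2, h3⟩
      refine hi ⟨fun h => h1 (Finset.mem_insert_of_mem h), h3.subset ?_⟩
      exact_mod_cast Finset.insert_subset_insert i (Finset.subset_insert j S)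
  by_cases hj : j ∉ S ∧ M.Indep (insert j S : Finset α)
  swap
  · rw [if_neg hj, if_neg]
    · simp
    · rintro ⟨h1, h2, h3⟩
      exact hj ⟨h2, h3.subset (by exact_mod_cast Finset.subset_insert i _)⟩
  rw [if_pos hi, if_pos hj]
  have hmem : M.closure (insert i S : Finset α) = M.closure (insert j S : Finset α) ↔
      ¬ (i ∉ insert j S ∧ j ∉ S ∧ M.Indep (insert i (insert j S) : Finset α)) := by
    constructor
    · rintro h ⟨h1, h2, h3⟩
      have h4 : i ∈ M.closure (insert j S : Finset α) :=
        h ▸ M.mem_closure_of_mem (by simp) hi.2.subset_ground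
      rw [hj.2.mem_closure_iff] at h4
      rcases h4 with h4 | h4
      · exact h4.not_indep (by simpa using h3)
      · exact h1 (by simpa using h4)
    · intro h
      have hsub (a b : α) (ha : a ∉ S ∧ M.Indep (insert a S : Finset α))
          (hb : b ∉ S ∧ M.Indep (insert b S : Finset α))
          (hab : ¬ (a ∉ insert b S ∧ b ∉ S ∧ M.Indep (insert a (insert b S) : Finset α))) :
          M.closure (insert a S : Finset α) ⊆ M.closure (insert b S : Finset α) := by
        refine M.closure_subset_closure_of_subset_closure ?_
        rw [Finset.coe_insert, Set.insert_subset_iff]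
        refine ⟨?_, (M.subset_closure _ hS.subset_ground).trans
          (M.closure_subset_closure (by simp))⟩
        rw [hb.2.mem_closure_iff']
        refine ⟨ha.2.subset_ground (by simp), fun h' => ?_⟩
        by_contra h''
        exact hab ⟨by simpa using h'', hb.1, by simpa using h'⟩
      refine (hsub i j hi hj h).antisymm (hsub j i hj hi ?_)
      rw [Finset.insert_comm j i]
      simp only [Finset.mem_insert] at h ⊢
      grind
  simp only [hmem]
  split_ifs <;> simp

/-- Hyperbolicity of the forms counting independent sets above `S`. -/
theorem borderedHyperbolic_link (m : ℕ) (hS : M.Indep (S : Set α)) (hp : p = #S + m) :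
    BorderedHyperbolic (indepAbove M p S) (linkBorder M p S) (linkMatrix M p S) := by
  induction m generalizing S with
  | zero => subst hp; exact borderedHyperbolic_link_base hS
  | succ m ih =>
    have hpm : (p : ℝ) - #S = m + 1 := by rw [hp]; push_cast; ring
    have hm : (0 : ℝ) < m + 1 := by positivity
    by_cases hrank : ∃ J : Finset α, M.Indep (J : Set α) ∧ #J = p + 2
    swap
    · refine ⟨1, 0, fun s v hs => ?_⟩
      have hs0 : s = 0 := by simpa using hs
      have : linkMatrix M p S = 0 := by
        ext i j
        have h0 := indepAbove_eq_zero (M := M) (n := p + 2) (T := insert i (insert j S))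
          fun I hI hI' _ => hrank ⟨I, hI, hI'⟩
        simp [linkMatrix_apply, h0]
      simp [borderedForm, hs0, this]
    obtain ⟨J, hJ, hJp⟩ := hrank
    have hext {T : Finset α} (hT : M.Indep (T : Set α)) (hTp : #T ≤ p + 2) :
        0 < indepAbove M (p + 2) T := by
      obtain ⟨I, hI, hIc, hTI⟩ := hT.exists_superset_card_eq hJ (hJp ▸ hTp)
      exact indepAbove_pos_iff.2 ⟨I, hI, hIc.trans hJp, hTI⟩
    have hrow (l : α) (hl : l ∉ S) : ∑ j, linkMatrix M p S l j =
        (m + 2) * indepAbove M (p + 2) (insert l S) := by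
      rw [sum_linkMatrix, if_neg hl]
      congr 1
      linarith
    have hrow_pos {l : α} (h : 0 < ∑ j, linkMatrix M p S l j) :
        l ∉ S ∧ M.Indep (insert l S : Finset α) := by
      have hl : l ∉ S := fun hl => by simp [sum_linkMatrix, hl] at h
      refine ⟨hl, ?_⟩
      by_contra hdep
      simp [hrow l hl, indepAbove_eq_zero_of_not_indep hdep] at h
    have hdep {l : α} (hl : l ∉ S) (h : ∑ j, linkMatrix M p S l j = 0) :
        ¬ M.Indep (insert l S : Finset α) := fun hi => by
      have := hext hi (by rw [Finset.card_insert_of_notMem hl]; omega)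
      rw [hrow l hl] at h
      exact (mul_pos (by positivity) this).ne' h
    have hedge {i j : α} (hi : i ∉ S) (hj : j ∉ S) (hij : i ≠ j)
        (h : M.Indep (insert i (insert j S) : Finset α)) : 0 < linkMatrix M p S i j := by
      rw [linkMatrix_apply, if_neg (by simp [hi, hij]), if_neg hj]
      refine hext h ?_
      rw [Finset.card_insert_of_notMem (by simp [hi, hij]), Finset.card_insert_of_notMem hj]
      omega
    refine borderedHyperbolic_of_le_sum_sq_div linkMatrix_isSymm linkMatrix_nonneg ?_ ?_ ?_
    · intro i hi
      by_cases hiS : i ∈ S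
      · simp [linkBorder, hiS]
      · rw [linkBorder, if_neg hiS, indepAbove_eq_zero_of_not_indep (hdep hiS hi)]
    · intro i j hi hj
      obtain ⟨hiS, hiI⟩ := hrow_pos hi
      obtain ⟨hjS, hjI⟩ := hrow_pos hj
      obtain ⟨k, -, hk⟩ := Finset.exists_lt_of_sum_lt
        (s := univ) (f := fun _ => (0 : ℝ)) (by simpa using hi)
      by_cases hij : i = j
      · exact Or.inl hij
      right
      have hik := hk
      rw [linkMatrix_apply] at hk
      split_ifs at hk with h1 h2
      · exact absurd hk (lt_irrefl _)
      · exact absurd hk (lt_irrefl _)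
      obtain ⟨I, hI, -, hsub⟩ := indepAbove_pos_iff.1 hk
      have hind : M.Indep (insert i (insert k S) : Finset α) := hI.subset (by exact_mod_cast hsub)
      obtain ⟨e, he, hej, heI⟩ := hjI.augment_finset hind (by
        rw [Finset.card_insert_of_notMem h1, Finset.card_insert_of_notMem h2,
          Finset.card_insert_of_notMem hjS]
        omega)
      simp only [Finset.mem_insert] at he hej
      push Not at hej
      rcases he with rfl | rfl | he
      · exact Or.inl (hedge hiS hjS hij (by simpa using heI))
      · exact Or.inr ⟨e, hik, hedge h2 hjS hej.1 (by simpa using heI)⟩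
      · exact absurd he hej.2
    · intro s v
      refine le_of_mul_le_mul_left ?_ hm
      rw [← hpm, ← sum_borderedForm_link, Finset.mul_sum]
      refine Finset.sum_le_sum fun l _ => ?_
      rw [hpm]
      have hDnn : 0 ≤ ∑ j, linkMatrix M p S l j :=
        Finset.sum_nonneg fun j _ => linkMatrix_nonneg l j
      split_ifs with hl
      · positivity
      rcases hDnn.eq_or_lt with hD | hD
      · have hz (n : ℕ) (T : Finset α) (hT : insert l S ⊆ T) : indepAbove M n T = 0 :=
          indepAbove_eq_zero_of_not_indep fun h =>
            hdep hl hD.symm (h.subset (by exact_mod_cast hT))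
        have hb : linkBorder M p (insert l S) = 0 := by
          ext i
          simp [linkBorder, hz _ _ (Finset.subset_insert i _)]
        have hB : linkMatrix M p (insert l S) = 0 := by
          ext i j
          simp [linkMatrix_apply,
            hz _ _ ((Finset.subset_insert j _).trans (Finset.subset_insert i _))]
        rw [hb, hB, hz _ _ subset_rfl, ← hD]
        simp [borderedForm]
      · have hcard : p = #(insert l S) + m := by
          rw [Finset.card_insert_of_notMem hl]; omega
        have hl1 (i : α) : ∑ j, linkMatrix M p (insert l S) i j =
            (m + 1) * linkMatrix M p S l i := by
          rw [sum_linkMatrix_insert hl, hpm, linkMatrix_isSymm.apply]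
        have hβ : ∑ i, ∑ j, linkMatrix M p (insert l S) i j =
            (m + 1) * ∑ j, linkMatrix M p S l j := by
          simp_rw [hl1, Finset.mul_sum]
        have hlin : ∑ i, (s * linkBorder M p (insert l S) i +
            (linkMatrix M p (insert l S) *ᵥ v) i) =
            (m + 1) * (s * linkBorder M p S l + (linkMatrix M p S *ᵥ v) l) := by
          rw [Finset.sum_add_distrib, ← Finset.mul_sum, sum_linkBorder_insert hl, hpm]
          have hmul : ∑ i, (linkMatrix M p (insert l S) *ᵥ v) i =
              ∑ j, (∑ i, linkMatrix M p (insert l S) i j) * v j := by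
            simp only [mulVec, dotProduct, Finset.sum_mul]
            exact Finset.sum_comm
          have hcol (j : α) : ∑ i, linkMatrix M p (insert l S) i j =
              (m + 1) * linkMatrix M p S l j := by
            rw [← hl1]
            exact Finset.sum_congr rfl fun i _ => linkMatrix_isSymm.apply _ _
          simp_rw [hmul, hcol, mul_assoc, ← Finset.mul_sum]
          simp only [mulVec, dotProduct]
          ring
        have key := (ih (hrow_pos hD).2 hcard).mul_le_sq linkMatrix_isSymm
          (by rw [hβ]; positivity) s v
        rw [hβ, hlin] at key
        rw [mul_div_assoc', le_div_iff₀ hD]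
        refine le_of_mul_le_mul_left ?_ hm
        linarith

/-- The `k`-element independent sets of a matroid on a finite type. -/
theorem indepCount_eq_indepAbove (k : ℕ) : (indepCount M k : ℝ) = indepAbove M k ∅ := by
  classical
  rw [indepAbove, indepCount, Nat.cast_inj, ← Set.ncard_coe_finset,
    ← Set.ncard_image_of_injective _ Finset.coe_injective]
  congr 1
  ext I
  simp only [Set.mem_ofPred_eq, Set.mem_image, Finset.coe_filter, Finset.mem_univ, true_and,
    Finset.empty_subset, and_true]
  constructor
  · rintro ⟨hI, hk⟩
    exact ⟨I.toFinset, ⟨by simpa using hI, by rw [← Set.ncard_eq_toFinset_card', hk]⟩, by simp⟩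
  · rintro ⟨J, ⟨hJ, hk⟩, rfl⟩
    exact ⟨hJ, by simpa using hk⟩

variable (M) in
theorem indepCount_mul_le_sq_of_fintype (p : ℕ) :
    indepCount M p * indepCount M (p + 2) ≤ indepCount M (p + 1) ^ 2 := by
  rw [← Nat.cast_le (α := ℝ)]
  push_cast
  simp only [indepCount_eq_indepAbove]
  have hnn := indepAbove_nonneg (M := M) (p + 2) ∅
  rcases hnn.eq_or_lt with h0 | hpos
  · rw [← h0, mul_zero]; positivity
  have hp : (0 : ℝ) < p + 1 := by positivity
  have hβ : ∑ i, ∑ j, linkMatrix M p ∅ i j = (p + 1) * ((p + 2) * indepAbove M (p + 2) ∅) := by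
    simpa using sum_sum_linkMatrix (M := M) (p := p) (S := ∅)
  have hc : ∑ i, linkBorder M p ∅ i = (p + 1) * indepAbove M (p + 1) ∅ := by
    simpa using sum_linkBorder (M := M) (p := p) (S := ∅)
  have key := (borderedHyperbolic_link (M := M) (p := p) (S := ∅) p (by simp) (by simp)).mul_le_sq
    linkMatrix_isSymm (by rw [hβ]; positivity) 1 0
  simp only [mulVec_zero, Pi.zero_apply, add_zero, one_mul, hc, hβ, borderedForm,
    dotProduct_zero, mul_zero, one_pow, mul_one] at key
  have h1 := indepAbove_nonneg (M := M) p ∅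
  refine le_of_mul_le_mul_left ?_ (mul_pos hp hp)
  nlinarith [mul_nonneg (mul_nonneg h1 hnn) hp.le]

end Matroid

theorem indepCount_restrictSubtype {α : Type*} (M : Matroid α) (k : ℕ) :
    indepCount (M.restrictSubtype M.E) k = indepCount M k := by
  rw [indepCount, indepCount,
    ← Set.ncard_image_of_injective _
      (Set.image_injective.2 (Subtype.val_injective (p := (· ∈ M.E))))]
  congr 1
  ext I
  simp only [Set.mem_image, Set.mem_ofPred_eq, Matroid.restrictSubtype_indep_iff]
  constructor
  · rintro ⟨J, ⟨hJ, hk⟩, rfl⟩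
    exact ⟨hJ, by rw [Set.ncard_image_of_injective _ Subtype.val_injective, hk]⟩
  · rintro ⟨hI, hk⟩
    have hIE : Subtype.val '' (Subtype.val ⁻¹' I : Set M.E) = I := by
      rw [Subtype.image_preimage_coe, Set.inter_eq_right.2 hI.subset_ground]
    refine ⟨Subtype.val ⁻¹' I, ⟨by rwa [hIE], ?_⟩, hIE⟩
    rw [← Set.ncard_image_of_injective _ Subtype.val_injective, hIE, hk]

/-- **Adiprasito–Huh–Katz** (conjectured by Welsh).  For a matroid `M` on a finite ground
set, the sequence `(i_k)` of counts of `k`-element independent sets is log-concave: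
`i_k² ≥ i_{k-1} · i_{k+1}` for all `k ≥ 1`. -/
theorem indep_count_log_concave {α : Type*} (M : Matroid α) (hE : M.E.Finite)
    (k : ℕ) (hk : 1 ≤ k) :
    indepCount M (k - 1) * indepCount M (k + 1) ≤ (indepCount M k) ^ 2 := by
  classical
  have : Fintype M.E := hE.fintype
  obtain ⟨p, rfl⟩ := Nat.exists_eq_add_of_le' hk
  simpa only [indepCount_restrictSubtype, Nat.add_sub_cancel] using
    indepCount_mul_le_sq_of_fintype (M.restrictSubtype M.E) p
end
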